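/- arXiv:1708.07330 — 7 statements merged into one kernel-verified Lean document; each statement's English description precedes it below -/
import Mathlib

section
/- Let d ≥ 1 and let [n] = V_1 ∪ ⋯ ∪ V_d be a partition into d disjoint nonempty blocks. Let I ⊆ R = K[x_1,…,x_n] be the edge ideal of the d-uniform complete d-partite clutter determined by this partition, i.e., I is generated by the monomials x_{j_1}⋯x_{j_d} with exactly one variable index from each block V_1,…,V_d. Then depth_R(I) = d, and Stanley's conjecture holds for I, i.e., sdepth(I) ≥ depth_R(I). -/
open MvPolynomial

/-- The Stanley space `u·K[Z]` inside `K[x_1,…,x_n]`: the `K`-subspace of all elements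
`u * f` where `f` is a polynomial in the variables indexed by `Z`. -/
noncomputable def stanleySpace {n : ℕ} {K : Type*} [Field K]
    (u : MvPolynomial (Fin n) K) (Z : Finset (Fin n)) :
    Submodule K (MvPolynomial (Fin n) K) :=
  Submodule.map (LinearMap.mulLeft K u)
    (Subalgebra.toSubmodule (MvPolynomial.supported K (↑Z : Set (Fin n))))

/-- A Stanley decomposition of a monomial ideal `I ⊆ K[x_1,…,x_n]`: a finite family of
monomials `u i` and sets of variables `Z i` such that `I` is the internal direct sum
(as a `K`-vector space) of the Stanley spaces `u i · K[Z i]`. -/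
def IsStanleyDecomp {n : ℕ} {K : Type*} [Field K]
    (I : Ideal (MvPolynomial (Fin n) K)) {r : ℕ}
    (u : Fin r → MvPolynomial (Fin n) K) (Z : Fin r → Finset (Fin n)) : Prop :=
  (∀ i, ∃ c : Fin n →₀ ℕ, u i = MvPolynomial.monomial c (1 : K)) ∧
  iSupIndep (fun i => stanleySpace (u i) (Z i)) ∧
  (⨆ i, stanleySpace (u i) (Z i)) = Submodule.restrictScalars K I

/-- The Stanley depth of a monomial ideal: the maximum over all Stanley decompositions
`I = ⊕ u_i K[Z_i]` of `min_i |Z_i|`. -/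
noncomputable def idealSdepth {n : ℕ} {K : Type*} [Field K]
    (I : Ideal (MvPolynomial (Fin n) K)) : ℕ :=
  sSup {m | ∃ (r : ℕ) (u : Fin r → MvPolynomial (Fin n) K) (Z : Fin r → Finset (Fin n)),
    IsStanleyDecomp I u Z ∧ ∀ i, m ≤ (Z i).card}

/-- The depth of a module `M` over `R` with respect to an ideal `m`: the supremum of the
lengths of `M`-regular sequences consisting of elements of `m`. -/
noncomputable def depthIn (R : Type*) [CommRing R] (m : Ideal R)
    (M : Type*) [AddCommGroup M] [Module R M] : ℕ :=
  sSup {k | ∃ rs : List R, rs.length = k ∧ (∀ r ∈ rs, r ∈ m) ∧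
    RingTheory.Sequence.IsRegular M rs}

section Ext

open RingTheory.Sequence CategoryTheory Abelian Pointwise

universe u

/-- If the groups `Ext N M i` vanish for all `i` up to the length of an `M`-regular sequence `rs`,
then there is no nonzero linear map from `N` to `M / rs M`. -/
lemma subsingleton_linearMap_quotient_of_subsingleton_ext {R : Type u} [CommRing R]
    (N M : ModuleCat.{u} R) (rs : List R) (reg : IsWeaklyRegular M rs)
    (h_ext : ∀ i ≤ rs.length, Subsingleton (Ext N M i)) :
    Subsingleton (N →ₗ[R] M ⧸ (Ideal.ofList rs • ⊤ : Submodule R M)) := by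
  induction rs generalizing M with
  | nil =>
    have h : Subsingleton (N →ₗ[R] M) :=
      have := h_ext 0 le_rfl
      (Ext.addEquiv₀.trans ModuleCat.homAddEquiv).symm.subsingleton
    have e : (M ⧸ (Ideal.ofList ([] : List R) • ⊤ : Submodule R M)) ≃ₗ[R] M :=
      Submodule.quotEquivOfEqBot _ (by simp)
    exact (e.congrRight : (N →ₗ[R] _) ≃ₗ[R] _).toEquiv.subsingleton
  | cons r rs ih =>
    rw [isWeaklyRegular_cons_iff] at reg
    have := ih (ModuleCat.of R (QuotSMulTop r M)) reg.2 fun i hi ↦ by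
      have zero1 := AddCommGrpCat.isZero_of_iff_subsingleton.mpr
        (h_ext i (by simp only [List.length_cons]; omega))
      have zero2 := AddCommGrpCat.isZero_of_iff_subsingleton.mpr
        (h_ext (i + 1) (by simp only [List.length_cons]; omega))
      exact AddCommGrpCat.subsingleton_of_isZero <| ShortComplex.Exact.isZero_of_both_zeros
        ((Ext.covariant_sequence_exact₃' N reg.1.smulShortComplex_shortExact) i (i + 1) rfl)
        (zero1.eq_zero_of_src _) (zero2.eq_zero_of_tgt _)
    exact ((Submodule.quotOfListConsSMulTopEquivQuotSMulTopInner M r rs).congrRight :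
      (N →ₗ[R] _) ≃ₗ[R] _).toEquiv.subsingleton

/-- An `M`-regular sequence in `m` is no longer than a given weakly regular sequence `rs` for which
`M / rs M` has a nonzero element annihilated by `m`. -/
lemma length_le_of_socle_ne_zero {R : Type u} [CommRing R] [IsNoetherianRing R] (m : Ideal R)
    (M : Type u) [AddCommGroup M] [Module R M] [Module.Finite R M]
    (smul_lt : m • (⊤ : Submodule R M) < ⊤) (rs : List R) (reg : IsWeaklyRegular M rs)
    (w : M) (hw : w ∉ (Ideal.ofList rs • ⊤ : Submodule R M))
    (hmw : ∀ r ∈ m, r • w ∈ (Ideal.ofList rs • ⊤ : Submodule R M))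
    (ss : List R) (hss : ∀ r ∈ ss, r ∈ m) (reg' : IsRegular M ss) :
    ss.length ≤ rs.length := by
  by_contra! hlt
  have h_ext : ∀ N : ModuleCat.{u} R, Nontrivial N → Module.Finite R N →
      Module.support R N ⊆ PrimeSpectrum.zeroLocus m →
      ∀ i < ss.length, Subsingleton (Ext N (ModuleCat.of R M) i) := by
    refine ((ModuleCat.exists_isRegular_tfae m ss.length (ModuleCat.of R M) smul_lt).out 0 3).mpr ?_
    exact ⟨ss, rfl, hss, reg'⟩
  have hm : Nontrivial (R ⧸ m) := by
    refine Submodule.Quotient.nontrivial_iff.mpr fun h ↦ ?_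
    simp [h] at smul_lt
  have hsub := subsingleton_linearMap_quotient_of_subsingleton_ext
    (ModuleCat.of R (R ⧸ m)) (ModuleCat.of R M) rs reg fun i hi ↦
      h_ext (ModuleCat.of R (R ⧸ m)) hm
        (inferInstanceAs (Module.Finite R (R ⧸ m)))
        (by
          change Module.support R (R ⧸ m) ⊆ _
          rw [Module.support_eq_zeroLocus, Ideal.annihilator_quotient])
        i (hi.trans_lt hlt)
  let φ : (R ⧸ m) →ₗ[R] M ⧸ (Ideal.ofList rs • ⊤ : Submodule R M) :=
    Submodule.liftQ m (LinearMap.toSpanSingleton R _ (Submodule.Quotient.mk w)) fun r hr ↦ by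
      simpa [← Submodule.Quotient.mk_smul, Submodule.Quotient.mk_eq_zero] using hmw r hr
  have hφ : φ (Submodule.Quotient.mk 1) = 0 := by
    have : φ = 0 := hsub.elim φ 0
    rw [this, LinearMap.zero_apply]
  apply hw
  rw [← Submodule.Quotient.mk_eq_zero]
  rwa [Submodule.liftQ_apply, LinearMap.toSpanSingleton_apply, one_smul] at hφ

end Ext

section StanleySpace

lemma stanleySpace_monomial {n : ℕ} {K : Type*} [Field K] (e : Fin n →₀ ℕ) (Z : Finset (Fin n)) :
    stanleySpace (monomial e (1 : K)) Z =
      restrictSupport K {c | e ≤ c ∧ ∀ j ∉ Z, c j = e j} := by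
  classical
  apply le_antisymm
  · rintro _ ⟨q, hq, rfl⟩
    rw [SetLike.mem_coe, Subalgebra.mem_toSubmodule, mem_supported] at hq
    rw [mem_restrictSupport_iff]
    intro c hc
    rw [LinearMap.mulLeft_apply, Finset.mem_coe, mem_support_iff, coeff_monomial_mul'] at hc
    have hec : e ≤ c := by
      by_contra h
      simp [h] at hc
    refine ⟨hec, fun j hj ↦ ?_⟩
    rw [if_pos hec, one_mul] at hc
    by_contra hne
    have h1 : (c - e) j ≠ 0 := by
      have := hec j
      rw [Finsupp.tsub_apply]
      omega
    exact hj (hq ((mem_vars_iff_mem_support j).mpr ⟨c - e, mem_support_iff.mpr hc,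
      Finsupp.mem_support_iff.mpr h1⟩))
  · rw [restrictSupport_eq_span, Submodule.span_le]
    rintro _ ⟨c, ⟨hec, hZ⟩, rfl⟩
    refine ⟨monomial (c - e) 1, ?_, ?_⟩
    · rw [SetLike.mem_coe, Subalgebra.mem_toSubmodule, mem_supported,
        vars_monomial one_ne_zero]
      intro j hj
      by_contra h
      simp [hZ j h] at hj
    · simp [monomial_mul, add_tsub_cancel_of_le hec]

lemma mem_restrictSupportIdeal_iff {σ R : Type*} [CommSemiring R] {s : Set (σ →₀ ℕ)}
    {hs : IsUpperSet s} {p : MvPolynomial σ R} :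
    p ∈ restrictSupportIdeal R s hs ↔ ∀ c ∈ p.support, c ∈ s := .rfl

lemma iSupIndep_restrictSupport {σ ι R : Type*} [CommSemiring R] (A : ι → Set (σ →₀ ℕ))
    (hA : Pairwise fun i j ↦ Disjoint (A i) (A j)) :
    iSupIndep fun i ↦ restrictSupport R (A i) := by
  intro i
  have hle : (⨆ j, ⨆ (_ : j ≠ i), restrictSupport R (A j)) ≤ restrictSupport R (A i)ᶜ :=
    iSup₂_le fun j hj ↦ restrictSupport_mono R (hA hj).subset_compl_right
  refine Disjoint.mono_right hle (Submodule.disjoint_def.mpr fun p hp hp' ↦ ?_)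
  rw [mem_restrictSupport_iff] at hp hp'
  rw [← support_eq_empty, Finset.eq_empty_iff_forall_notMem]
  exact fun c hc ↦ hp' hc (hp hc)

lemma iSup_restrictSupport {σ ι R : Type*} [CommSemiring R] (A : ι → Set (σ →₀ ℕ)) :
    (⨆ i, restrictSupport R (A i)) = restrictSupport R (⋃ i, A i) := by
  apply le_antisymm
  · exact iSup_le fun i ↦ restrictSupport_mono R (Set.subset_iUnion A i)
  · rw [restrictSupport_eq_span, Submodule.span_le]
    rintro _ ⟨c, hc, rfl⟩
    obtain ⟨i, hi⟩ := Set.mem_iUnion.mp hc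
    exact Submodule.mem_iSup_of_mem i (monomial_mem_restrictSupport R |>.mpr (Or.inl hi))

/-- A finite partition of the exponents of a monomial ideal into shifted orthants whose
dimensions are all at least `m` bounds the Stanley depth from below. -/
lemma le_idealSdepth {n m : ℕ} {K : Type*} [Field K] (I : Ideal (MvPolynomial (Fin n) K))
    (hI : I ≠ ⊥) (S : Set (Fin n →₀ ℕ)) (hIS : I.restrictScalars K = restrictSupport K S)
    {F : Type*} [Finite F] (e : F → Fin n →₀ ℕ) (Z : F → Finset (Fin n))
    (hdisj : Pairwise fun f g ↦ Disjoint {c | e f ≤ c ∧ ∀ j ∉ Z f, c j = e f j}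
      {c | e g ≤ c ∧ ∀ j ∉ Z g, c j = e g j})
    (hS : ⋃ f, {c | e f ≤ c ∧ ∀ j ∉ Z f, c j = e f j} = S) (hm : ∀ f, m ≤ (Z f).card) :
    m ≤ idealSdepth I := by
  obtain ⟨r, ⟨φ⟩⟩ := Finite.exists_equiv_fin F
  refine le_csSup ⟨n, ?_⟩ ⟨r, fun i ↦ monomial (e (φ.symm i)) 1, fun i ↦ Z (φ.symm i),
    ⟨fun i ↦ ⟨_, rfl⟩, ?_, ?_⟩, fun i ↦ hm _⟩
  · rintro k ⟨s, u, Z', ⟨-, -, hsup⟩, hk⟩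
    rcases s with - | s
    · exfalso
      apply hI
      rw [iSup_of_empty, eq_comm, Submodule.restrictScalars_eq_bot_iff] at hsup
      exact hsup
    · exact (hk 0).trans (card_finset_fin_le _)
  · simp only [stanleySpace_monomial]
    exact iSupIndep_restrictSupport _ fun i j hij ↦ hdisj (φ.symm.injective.ne hij)
  · simp only [stanleySpace_monomial]
    rw [iSup_restrictSupport, hIS, ← hS,
      φ.symm.surjective.iUnion_comp fun f ↦ {c | e f ≤ c ∧ ∀ j ∉ Z f, c j = e f j}]

end StanleySpace

section Transversal

variable {n d : ℕ} (b : Fin n → Fin d)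

/-- The exponents of the monomials involving a variable from each block, where `b` assigns to each
variable its block. -/
def transversalSupport : Set (Fin n →₀ ℕ) := {c | ∀ i, ∃ j, b j = i ∧ c j ≠ 0}

/-- The exponent of the product of the variables selected by the section `f` of `b`. -/
noncomputable def transversalExponent (f : Fin d → Fin n) : Fin n →₀ ℕ :=
  Finsupp.equivFunOnFinite.symm fun j ↦ if f (b j) = j then 1 else 0

lemma transversalExponent_apply (f : Fin d → Fin n) (j : Fin n) :
    transversalExponent b f j = if f (b j) = j then 1 else 0 := rfl

lemma isUpperSet_transversalSupport : IsUpperSet (transversalSupport b) := by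
  intro c c' hcc' hc i
  obtain ⟨j, hj, hcj⟩ := hc i
  have := hcc' j
  exact ⟨j, hj, by omega⟩

variable {b}

lemma transversalExponent_le_iff {f : Fin d → Fin n} (hf : ∀ i, b (f i) = i) {c : Fin n →₀ ℕ} :
    transversalExponent b f ≤ c ↔ ∀ i, c (f i) ≠ 0 := by
  refine ⟨fun h i ↦ ?_, fun h j ↦ ?_⟩
  · have := h (f i)
    rw [transversalExponent_apply, hf, if_pos rfl] at this
    omega
  · rw [transversalExponent_apply]
    split_ifs with hj
    · have := h (b j)
      rw [hj] at this
      omega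
    · exact Nat.zero_le _

lemma transversalExponent_mem {f : Fin d → Fin n} (hf : ∀ i, b (f i) = i) :
    transversalExponent b f ∈ transversalSupport b :=
  fun i ↦ ⟨f i, hf i, (transversalExponent_le_iff hf).mp le_rfl i⟩

lemma mem_transversalSupport_iff {c : Fin n →₀ ℕ} :
    c ∈ transversalSupport b ↔
      ∃ f : Fin d → Fin n, (∀ i, b (f i) = i) ∧ transversalExponent b f ≤ c := by
  constructor
  · intro h
    choose f hf hc using h
    exact ⟨f, hf, (transversalExponent_le_iff hf).mpr hc⟩
  · rintro ⟨f, hf, hc⟩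
    exact isUpperSet_transversalSupport b hc (transversalExponent_mem hf)

lemma prod_X_eq_monomial_transversalExponent {K : Type*} [CommSemiring K] (f : Fin d → Fin n) :
    ∏ j with f (b j) = j, (X j : MvPolynomial (Fin n) K) =
      monomial (transversalExponent b f) 1 := by
  rw [monomial_eq, C_1, one_mul, Finsupp.prod_fintype _ _ fun _ ↦ pow_zero _, Finset.prod_filter]
  refine Finset.prod_congr rfl fun j _ ↦ ?_
  rw [transversalExponent_apply]
  split_ifs <;> simp

variable (b)

/-- The edge ideal of the complete `d`-partite clutter with blocks the fibres of `b`. -/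
lemma span_transversals_eq_restrictSupportIdeal {K : Type*} [Field K] (V : Fin d → Finset (Fin n))
    (hV : ∀ i j, j ∈ V i ↔ b j = i) :
    Ideal.span {m : MvPolynomial (Fin n) K | ∃ e : Finset (Fin n), e.card = d ∧
        (∀ i, (e ∩ V i).card = 1) ∧ m = ∏ j ∈ e, X j } =
      restrictSupportIdeal K (transversalSupport b) (isUpperSet_transversalSupport b) := by
  have hset : {m : MvPolynomial (Fin n) K | ∃ e : Finset (Fin n), e.card = d ∧
        (∀ i, (e ∩ V i).card = 1) ∧ m = ∏ j ∈ e, X j } =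
      (fun s ↦ monomial s (1 : K)) ''
        (transversalExponent b '' {f | ∀ i, b (f i) = i}) := by
    ext m
    constructor
    · rintro ⟨e, -, he, rfl⟩
      choose f hf using fun i ↦ Finset.card_eq_one.mp (he i)
      have hfe (i : Fin d) (j : Fin n) : (j ∈ e ∧ b j = i) ↔ j = f i := by
        rw [← hV, ← Finset.mem_inter, hf, Finset.mem_singleton]
      refine ⟨_, ⟨f, fun i ↦ ((hfe i (f i)).mpr rfl).2, rfl⟩, ?_⟩
      change monomial _ _ = _
      rw [← prod_X_eq_monomial_transversalExponent]
      congr 1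
      ext j
      simpa [eq_comm] using (hfe (b j) j).symm
    · rintro ⟨_, ⟨f, hf, rfl⟩, rfl⟩
      have hmem (i : Fin d) (j : Fin n) : (f (b j) = j ∧ b j = i) ↔ j = f i := by
        constructor
        · rintro ⟨h, rfl⟩
          exact h.symm
        · rintro rfl
          simp [show b (f i) = i from hf i]
      refine ⟨({j | f (b j) = j} : Finset (Fin n)), ?_, fun i ↦ ?_,
        (prod_X_eq_monomial_transversalExponent f).symm⟩
      · have : ({j | f (b j) = j} : Finset (Fin n)) = Finset.univ.image f := by
          ext j
          simp only [Finset.mem_filter_univ, Finset.mem_image, Finset.mem_univ, true_and]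
          exact ⟨fun h ↦ ⟨_, h⟩, fun ⟨i, hi⟩ ↦ by rw [← hi, hf i]⟩
        rw [this, Finset.card_image_of_injective _ (Function.LeftInverse.injective hf),
          Finset.card_univ, Fintype.card_fin]
      · rw [Finset.card_eq_one]
        refine ⟨f i, ?_⟩
        ext j
        simp [hV, hmem]
  ext p
  rw [hset, mem_ideal_span_monomial_image]
  change _ ↔ ↑p.support ⊆ transversalSupport b
  simp only [Set.subset_def, mem_transversalSupport_iff, Set.exists_mem_image, Finset.mem_coe]
  rfl

lemma restrictSupportIdeal_transversalSupport_ne_bot {K : Type*} [Field K] {f : Fin d → Fin n}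
    (hf : ∀ i, b (f i) = i) : restrictSupportIdeal K (transversalSupport b)
      (isUpperSet_transversalSupport b) ≠ ⊥ := by
  refine (Submodule.ne_bot_iff _).mpr ⟨monomial (transversalExponent b f) 1, ?_, by simp⟩
  exact (monomial_mem_restrictSupport K).mpr (Or.inl (transversalExponent_mem hf))

lemma le_idealSdepth_transversalSupport {K : Type*} [Field K] {f₀ : Fin d → Fin n}
    (hf₀ : ∀ i, b (f₀ i) = i) :
    d ≤ idealSdepth (restrictSupportIdeal K (transversalSupport b)
      (isUpperSet_transversalSupport b)) := by
  have hcell (f : {f : Fin d → Fin n // ∀ i, b (f i) = i}) (c : Fin n →₀ ℕ) :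
      (transversalExponent b f ≤ c ∧ ∀ j ∉ (({k | f.1 (b k) ≤ k} : Finset (Fin n))),
        c j = transversalExponent b f j) ↔
      ∀ i, c (f.1 i) ≠ 0 ∧ ∀ j, b j = i → j < f.1 i → c j = 0 := by
    rw [transversalExponent_le_iff f.2, forall_and]
    refine and_congr_right fun _ ↦ ?_
    simp only [Finset.mem_filter_univ, not_le, transversalExponent_apply]
    constructor
    · intro h i j hij hj
      subst hij
      rw [h j hj, if_neg hj.ne']
    · intro h j hj
      rw [if_neg hj.ne', h _ j rfl hj]
  refine le_idealSdepth _ (restrictSupportIdeal_transversalSupport_ne_bot b hf₀)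
    (transversalSupport b) (restrictScalars_restrictSupportIdeal ..)
    (F := {f : Fin d → Fin n // ∀ i, b (f i) = i})
    (fun f ↦ transversalExponent b f) (fun f ↦ {k | f.1 (b k) ≤ k}) ?_ ?_ ?_
  · intro f g hfg
    refine Set.disjoint_left.mpr fun c hc hc' ↦ hfg (Subtype.ext (funext fun i ↦ ?_))
    simp only [Set.mem_ofPred_eq, hcell] at hc hc'
    refine le_antisymm ?_ ?_
    · by_contra! h
      exact (hc' i).1 ((hc i).2 _ (g.2 i) h)
    · by_contra! h
      exact (hc i).1 ((hc' i).2 _ (f.2 i) h)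
  · ext c
    simp only [Set.mem_iUnion, Set.mem_ofPred_eq, hcell]
    constructor
    · rintro ⟨f, hf⟩ i
      exact ⟨f.1 i, f.2 i, (hf i).1⟩
    · intro hc
      have hmin (i : Fin d) : ∃ j, (b j = i ∧ c j ≠ 0) ∧ ∀ k, b k = i ∧ c k ≠ 0 → j ≤ k := by
        obtain ⟨j, hj⟩ := hc i
        obtain ⟨k, hk, hk'⟩ := Set.exists_min_image {j | b j = i ∧ c j ≠ 0} id
          (Set.toFinite _) ⟨j, hj⟩
        exact ⟨k, hk, hk'⟩
      choose f hf hf' using hmin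
      refine ⟨⟨f, fun i ↦ (hf i).1⟩, fun i ↦ ⟨(hf i).2, fun j hj hlt ↦ ?_⟩⟩
      by_contra h
      exact (hf' i j ⟨hj, h⟩).not_gt hlt
  · intro f
    calc d = (Finset.univ.image f.1).card := by
          rw [Finset.card_image_of_injective _ (Function.LeftInverse.injective f.2),
            Finset.card_univ, Fintype.card_fin]
      _ ≤ _ := Finset.card_le_card fun j hj ↦ by
          obtain ⟨i, -, rfl⟩ := Finset.mem_image.mp hj
          simp [f.2 i]

lemma Ideal.span_mul_le_of_forall {R : Type*} [CommSemiring R] {s : Set R} {J L : Ideal R}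
    (h : ∀ a ∈ s, ∀ p ∈ J, a * p ∈ L) : Ideal.span s * J ≤ L := by
  refine Ideal.mul_le.mpr fun a ha p hp ↦ ?_
  refine Submodule.span_induction (p := fun q _ ↦ q * p ∈ L) (fun q hq ↦ h q hq p hp) (by simp)
    (fun q q' _ _ hq hq' ↦ ?_) (fun r q _ hq ↦ ?_) ha
  · rw [add_mul]
    exact add_mem hq hq'
  · rw [smul_eq_mul, mul_assoc]
    exact Ideal.mul_mem_left _ _ hq

/-- The exponents of the monomials in the product of the ideal of exponents `transversalSupport b`
with the ideal generated by the variables `y i` for `i ∈ A`. -/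
def shiftedTransversalSupport (y : Fin d → Fin n) (A : Set (Fin d)) : Set (Fin n →₀ ℕ) :=
  {c | ∃ i ∈ A, ∃ s ∈ transversalSupport b, c = Finsupp.single (y i) 1 + s}

lemma isUpperSet_shiftedTransversalSupport (y : Fin d → Fin n) (A : Set (Fin d)) :
    IsUpperSet (shiftedTransversalSupport b y A) := by
  rintro c c' hcc' ⟨i, hi, s, hs, rfl⟩
  refine ⟨i, hi, s + (c' - (Finsupp.single (y i) 1 + s)),
    isUpperSet_transversalSupport b le_self_add hs, ?_⟩
  rw [← add_assoc, add_tsub_cancel_of_le hcc']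

lemma span_X_mul_restrictSupportIdeal {K : Type*} [Field K] (y : Fin d → Fin n)
    (A : Set (Fin d)) :
    Ideal.span ((fun i ↦ (X (y i) : MvPolynomial (Fin n) K)) '' A) *
        restrictSupportIdeal K (transversalSupport b) (isUpperSet_transversalSupport b) =
      restrictSupportIdeal K (shiftedTransversalSupport b y A)
        (isUpperSet_shiftedTransversalSupport b y A) := by
  apply le_antisymm
  · refine Ideal.span_mul_le_of_forall ?_
    rintro _ ⟨i, hi, rfl⟩ p hp
    refine mem_restrictSupportIdeal_iff.mpr fun c hc ↦ ?_
    rw [support_X_mul] at hc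
    obtain ⟨s, hs, rfl⟩ := Finset.mem_map.mp hc
    exact ⟨i, hi, s, hp hs, rfl⟩
  · intro p hp
    have hp : p ∈ restrictSupport K (shiftedTransversalSupport b y A) := hp
    rw [restrictSupport_eq_span] at hp
    refine Submodule.span_induction (p := fun q _ ↦ q ∈ _) ?_ (zero_mem _)
      (fun _ _ _ _ ↦ add_mem) (fun a q _ hq ↦ ?_) hp
    · rintro _ ⟨_, ⟨i, hi, s, hs, rfl⟩, rfl⟩
      have : monomial (Finsupp.single (y i) 1 + s) (1 : K) = X (y i) * monomial s 1 := by
        simp [X, monomial_mul]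
      simp only [this]
      exact Ideal.mul_mem_mul (Ideal.subset_span ⟨i, hi, rfl⟩)
        ((monomial_mem_restrictSupport K).mpr (Or.inl hs))
    · rw [smul_eq_C_mul]
      exact Ideal.mul_mem_left _ _ hq

variable {b}

lemma mem_shiftedTransversalSupport_of_single_add {y : Fin d → Fin n} (hy : ∀ i, b (y i) = i)
    {A : Set (Fin d)} {k : Fin d} (hk : k ∉ A) {c : Fin n →₀ ℕ} (hc : c ∈ transversalSupport b)
    (h : Finsupp.single (y k) 1 + c ∈ shiftedTransversalSupport b y A) :
    c ∈ shiftedTransversalSupport b y A := by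
  obtain ⟨i, hi, s, hs, heq⟩ := h
  have hik : i ≠ k := fun h ↦ hk (h ▸ hi)
  have happ (j : Fin n) : (if y k = j then 1 else 0) + c j = (if y i = j then 1 else 0) + s j := by
    simpa [Finsupp.single_apply] using DFunLike.congr_fun heq j
  have hne : y k ≠ y i := fun h ↦ hik (by rw [← hy i, ← h, hy])
  have hyi : Finsupp.single (y i) 1 ≤ c := by
    rw [Finsupp.single_le_iff]
    have := happ (y i)
    rw [if_neg hne, if_pos rfl] at this
    omega
  refine ⟨i, hi, c - Finsupp.single (y i) 1, fun l ↦ ?_, (add_tsub_cancel_of_le hyi).symm⟩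
  have hcs (j : Fin n) (hj : j ≠ y k) :
      (c - Finsupp.single (y i) 1 : Fin n →₀ ℕ) j = s j := by
    have := happ j
    rw [if_neg hj.symm] at this
    rw [Finsupp.tsub_apply, Finsupp.single_apply]
    omega
  by_cases hl : l = k
  · obtain ⟨j, hj, hcj⟩ := hc l
    refine ⟨j, hj, ?_⟩
    have hji : y i ≠ j := by
      rintro rfl
      exact hik (by rw [← hy i, hj, hl])
    rwa [Finsupp.tsub_apply, Finsupp.single_apply, if_neg hji, Nat.sub_zero]
  · obtain ⟨j, hj, hsj⟩ := hs l
    refine ⟨j, hj, ?_⟩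
    rwa [hcs j (by rintro rfl; exact hl (by rw [← hj, hy]))]

lemma transversalExponent_notMem_shiftedTransversalSupport (y : Fin d → Fin n)
    (A : Set (Fin d)) :
    transversalExponent b y ∉ shiftedTransversalSupport b y A := by
  rintro ⟨i, -, s, hs, heq⟩
  obtain ⟨j, hj, hsj⟩ := hs i
  have := DFunLike.congr_fun heq j
  rw [transversalExponent_apply, hj, Finsupp.add_apply, Finsupp.single_apply] at this
  split_ifs at this <;> omega

lemma single_add_transversalExponent_mem {y : Fin d → Fin n} (hy : ∀ i, b (y i) = i)
    (j : Fin n) :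
    Finsupp.single j 1 + transversalExponent b y ∈ shiftedTransversalSupport b y Set.univ := by
  have hle : Finsupp.single (y (b j)) 1 ≤ transversalExponent b y := by
    rw [Finsupp.single_le_iff, transversalExponent_apply, hy, if_pos rfl]
  refine ⟨b j, Set.mem_univ _,
    Finsupp.single j 1 + (transversalExponent b y - Finsupp.single (y (b j)) 1), fun l ↦ ?_, ?_⟩
  · by_cases hl : b j = l
    · exact ⟨j, hl, by simp⟩
    · refine ⟨y l, hy l, ?_⟩
      have : y (b j) ≠ y l := fun h ↦ hl (by rw [← hy (b j), h, hy])
      rw [Finsupp.add_apply, Finsupp.tsub_apply, Finsupp.single_apply (a := y (b j)), if_neg this,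
        transversalExponent_apply, hy, if_pos rfl]
      omega
  · rw [add_left_comm, add_tsub_cancel_of_le hle]

lemma degree_of_mem_transversalSupport {c : Fin n →₀ ℕ} (hc : c ∈ transversalSupport b) :
    d ≤ c.degree := by
  choose f hf hcf using hc
  calc d = ∑ i : Fin d, 1 := by simp
    _ ≤ ∑ i, c (f i) := Finset.sum_le_sum fun i _ ↦ Nat.one_le_iff_ne_zero.mpr (hcf i)
    _ = ∑ j ∈ Finset.univ.image f, c j :=
        (Finset.sum_image (Function.LeftInverse.injective hf).injOn).symm
    _ ≤ ∑ j, c j := Finset.sum_le_sum_of_subset (Finset.subset_univ _)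
    _ = c.degree := (Finsupp.degree_eq_sum c).symm

lemma degree_transversalExponent {f : Fin d → Fin n} (hf : ∀ i, b (f i) = i) :
    (transversalExponent b f).degree = d := by
  rw [Finsupp.degree_eq_sum]
  simp only [transversalExponent_apply]
  rw [Finset.sum_boole, Nat.cast_id]
  have : ({j | f (b j) = j} : Finset (Fin n)) = Finset.univ.image f := by
    ext j
    simp only [Finset.mem_filter_univ, Finset.mem_image, Finset.mem_univ, true_and]
    exact ⟨fun h ↦ ⟨_, h⟩, fun ⟨i, hi⟩ ↦ by rw [← hi, hf i]⟩
  rw [this, Finset.card_image_of_injective _ (Function.LeftInverse.injective hf),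
    Finset.card_univ, Fintype.card_fin]

variable (b)

lemma depthIn_restrictSupportIdeal {K : Type*} [Field K] {y : Fin d → Fin n}
    (hy : ∀ i, b (y i) = i) :
    depthIn (MvPolynomial (Fin n) K)
      (Ideal.span (Set.range (X : Fin n → MvPolynomial (Fin n) K)))
      (restrictSupportIdeal K (transversalSupport b) (isUpperSet_transversalSupport b)) = d := by
  set m := Ideal.span (Set.range (X : Fin n → MvPolynomial (Fin n) K))
  set I := restrictSupportIdeal K (transversalSupport b) (isUpperSet_transversalSupport b)
  have hmem_smul (J : Ideal (MvPolynomial (Fin n) K)) (x : I) :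
      x ∈ (J • ⊤ : Submodule (MvPolynomial (Fin n) K) I) ↔ (x : MvPolynomial (Fin n) K) ∈ J * I := by
    have : J * I = (J • ⊤ : Submodule (MvPolynomial (Fin n) K) I).map I.subtype := by
      rw [Submodule.map_smul'', Submodule.map_top, Submodule.range_subtype, smul_eq_mul]
    rw [this]
    exact (Function.Injective.mem_set_image I.subtype_injective).symm
  let rs := List.ofFn fun i ↦ (X (y i) : MvPolynomial (Fin n) K)
  have hlen : rs.length = d := List.length_ofFn
  have htake (k : ℕ) : Ideal.ofList (rs.take k) =
      Ideal.span ((fun i ↦ (X (y i) : MvPolynomial (Fin n) K)) '' {i | i.1 < k}) := by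
    rw [Ideal.ofList]
    congr 1
    ext p
    simp only [rs, List.mem_take_iff_getElem, List.getElem_ofFn, List.length_ofFn, Set.mem_image]
    constructor
    · rintro ⟨i, hi, rfl⟩
      exact ⟨⟨i, by omega⟩, (lt_min_iff.mp hi).1, rfl⟩
    · rintro ⟨i, hi, rfl⟩
      exact ⟨i, lt_min hi i.2, rfl⟩
  have hall : Ideal.ofList rs * I = restrictSupportIdeal K
      (shiftedTransversalSupport b y Set.univ) (isUpperSet_shiftedTransversalSupport b y _) := by
    have : Set.univ = {i : Fin d | i.1 < rs.length} := by
      ext i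
      simp [hlen]
    rw [← span_X_mul_restrictSupportIdeal, this, ← htake, List.take_length]
  have hreg : RingTheory.Sequence.IsWeaklyRegular I rs := by
    refine ⟨fun k hk ↦ ?_⟩
    rw [isSMulRegular_quotient_iff_mem_of_smul_mem]
    intro x hx
    rw [hmem_smul, htake, span_X_mul_restrictSupportIdeal] at hx ⊢
    refine mem_restrictSupportIdeal_iff.mpr fun c hc ↦ ?_
    refine mem_shiftedTransversalSupport_of_single_add hy (k := ⟨k, hlen ▸ hk⟩)
      (by simp) (x.2 hc) (mem_restrictSupportIdeal_iff.mp hx _ ?_)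
    have hkX : rs[k] = X (y ⟨k, hlen ▸ hk⟩) := List.getElem_ofFn _
    rw [Submodule.coe_smul, smul_eq_mul, hkX, mem_support_iff, add_comm,
      mul_comm, coeff_mul_X]
    exact mem_support_iff.mp hc
  let w : I := ⟨monomial (transversalExponent b y) 1,
    (monomial_mem_restrictSupport K).mpr (Or.inl (transversalExponent_mem hy))⟩
  have hw : w ∉ (Ideal.ofList rs • ⊤ : Submodule (MvPolynomial (Fin n) K) I) := by
    rw [hmem_smul, hall]
    intro h
    rcases (monomial_mem_restrictSupport K).mp h with h | h
    · exact transversalExponent_notMem_shiftedTransversalSupport y _ h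
    · exact one_ne_zero h
  have hmw : ∀ r ∈ m, r • w ∈ (Ideal.ofList rs • ⊤ : Submodule (MvPolynomial (Fin n) K) I) := by
    intro r hr
    rw [hmem_smul, hall]
    change r * monomial (transversalExponent b y) 1 ∈ _
    refine Submodule.span_induction (p := fun q _ ↦ q * _ ∈ _) ?_ (by simp)
      (fun p q _ _ hp hq ↦ ?_) (fun a q _ hq ↦ ?_) hr
    · rintro _ ⟨j, rfl⟩
      rw [X, monomial_mul, one_mul]
      exact (monomial_mem_restrictSupport K).mpr (Or.inl (single_add_transversalExponent_mem hy j))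
    · rw [add_mul]
      exact add_mem hp hq
    · rw [smul_eq_mul, mul_assoc]
      exact Ideal.mul_mem_left _ _ hq
  have hlt : m • (⊤ : Submodule (MvPolynomial (Fin n) K) I) < ⊤ := by
    refine lt_top_iff_ne_top.mpr fun h ↦ ?_
    have hwm : w ∈ m • (⊤ : Submodule (MvPolynomial (Fin n) K) I) := by
      rw [h]
      exact Submodule.mem_top
    rw [hmem_smul] at hwm
    have hupper : IsUpperSet {c : Fin n →₀ ℕ | d + 1 ≤ c.degree} :=
      fun c c' hcc' hc ↦ le_trans hc (Finsupp.degree_mono hcc')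
    have hle : m * I ≤ restrictSupportIdeal K _ hupper := by
      refine Ideal.span_mul_le_of_forall ?_
      rintro _ ⟨j, rfl⟩ p hp
      refine mem_restrictSupportIdeal_iff.mpr fun c hc ↦ ?_
      rw [support_X_mul] at hc
      obtain ⟨s, hs, rfl⟩ := Finset.mem_map.mp hc
      have := degree_of_mem_transversalSupport (hp hs)
      simp [Finsupp.degree_single]
      omega
    rcases (monomial_mem_restrictSupport K).mp (hle hwm) with h | h
    · have h : d + 1 ≤ (transversalExponent b y).degree := h
      rw [degree_transversalExponent hy] at h
      omega
    · exact one_ne_zero h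
  refine IsGreatest.csSup_eq ⟨⟨rs, hlen, ?_, hreg, fun h ↦ hw (h ▸ Submodule.mem_top)⟩, ?_⟩
  · intro r hr
    obtain ⟨i, rfl⟩ := List.mem_ofFn.mp hr
    exact Ideal.subset_span ⟨_, rfl⟩
  · rintro _ ⟨ss, rfl, hss, hss'⟩
    rw [← hlen]
    exact length_le_of_socle_ne_zero m I hlt rs hreg w hw hmw ss hss hss'

end Transversal

/-- Let `[n] = V 0 ∪ ⋯ ∪ V (d-1)` be a partition into `d` disjoint nonempty blocks and let
`I` be the edge ideal of the `d`-uniform complete `d`-partite clutter on this partition,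
generated by the monomials `∏_{j ∈ e} x_j` over the `d`-subsets `e` meeting every block
exactly once. Then `depth_R I = d` and Stanley's conjecture holds for `I`, i.e.
`sdepth I ≥ depth_R I`. -/
theorem stanley_conjecture_complete_d_partite {n d : ℕ} (hd : 1 ≤ d)
    (K : Type*) [Field K]
    (V : Fin d → Finset (Fin n))
    (hV_nonempty : ∀ i, (V i).Nonempty)
    (hV_disjoint : ∀ i j, i ≠ j → Disjoint (V i) (V j))
    (hV_cover : ∀ x : Fin n, ∃ i, x ∈ V i)
    (I : Ideal (MvPolynomial (Fin n) K))
    (hI : I = Ideal.span { m | ∃ e : Finset (Fin n), e.card = d ∧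
        (∀ i, (e ∩ V i).card = 1) ∧ m = ∏ j ∈ e, MvPolynomial.X j }) :
    depthIn (MvPolynomial (Fin n) K)
        (Ideal.span (Set.range (MvPolynomial.X : Fin n → MvPolynomial (Fin n) K))) I = d ∧
      depthIn (MvPolynomial (Fin n) K)
        (Ideal.span (Set.range (MvPolynomial.X : Fin n → MvPolynomial (Fin n) K))) I ≤
        idealSdepth I := by
  choose b hb using hV_cover
  have hV : ∀ i j, j ∈ V i ↔ b j = i := fun i j ↦ by
    refine ⟨fun h ↦ ?_, fun h ↦ h ▸ hb j⟩
    by_contra hne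
    exact Finset.disjoint_left.mp (hV_disjoint _ _ hne) (hb j) h
  choose y hy using hV_nonempty
  have hby : ∀ i, b (y i) = i := fun i ↦ (hV i (y i)).mp (hy i)
  rw [span_transversals_eq_restrictSupportIdeal b V hV] at hI
  subst hI
  rw [depthIn_restrictSupportIdeal b hby]
  exact ⟨rfl, le_idealSdepth_transversalSupport b hby⟩
end

section
/- Let [n] = V_1 ∪ ⋯ ∪ V_d be a partition into d disjoint blocks with |V_i| = r_i and 2 ≤ r_1 ≤ ⋯ ≤ r_d. Let P be the characteristic poset of the d-uniform complete d-partite clutter determined by this partition (P = {C ⊆ [n] : C contains some edge}). Then d ≤ sdepth(P) ≤ d + Σ_{i=1}^{d} (r_i − 1)/2. -/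
/-- A partition of a family `P` of subsets of `[n]` into intervals `[C,D] = {S : C ⊆ S ⊆ D}`:
a finite collection of intervals, each contained in `P`, such that every member of `P`
lies in exactly one of them. -/
def IsIntervalPartition {n : ℕ} (P : Finset (Finset (Fin n)))
    (D : Finset (Finset (Fin n) × Finset (Fin n))) : Prop :=
  (∀ p ∈ D, p.1 ⊆ p.2) ∧
  (∀ p ∈ D, ∀ S : Finset (Fin n), p.1 ⊆ S → S ⊆ p.2 → S ∈ P) ∧
  (∀ S ∈ P, ∃! p : Finset (Fin n) × Finset (Fin n), p ∈ D ∧ p.1 ⊆ S ∧ S ⊆ p.2)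

/-- The Stanley depth of a family `P` of subsets of `[n]`: the maximum over all interval
partitions of `P` of the minimum cardinality of the top sets `D_j` of the intervals. -/
noncomputable def posetSdepth {n : ℕ} (P : Finset (Finset (Fin n))) : ℕ :=
  sSup {m | ∃ D, IsIntervalPartition P D ∧ ∀ p ∈ D, m ≤ p.2.card}

/-- The characteristic poset of the edge ideal of a clutter with edge set `E`:
all subsets of `[n]` containing some edge. -/
def charPoset {n : ℕ} (E : Finset (Finset (Fin n))) : Finset (Finset (Fin n)) :=
  Finset.univ.filter (fun C => ∃ e ∈ E, e ⊆ C)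

/-- The edge set of the `d`-uniform complete `d`-partite clutter on the partition
`[n] = V 0 ∪ ⋯ ∪ V (d-1)`: all `d`-element subsets meeting every block exactly once. -/
def completeDPartiteEdges {n d : ℕ} (V : Fin d → Finset (Fin n)) :
    Finset (Finset (Fin n)) :=
  (Finset.powersetCard d (Finset.univ : Finset (Fin n))).filter
    (fun e => ∀ i, (e ∩ V i).card = 1)

open Finset in
/-- A transversal of pairwise disjoint blocks has as many elements as there are blocks. -/
theorem card_image_transversal {n d : ℕ} {V : Fin d → Finset (Fin n)}
    (hdisj : ∀ i j, i ≠ j → Disjoint (V i) (V j)) {f : Fin d → Fin n} (hf : ∀ i, f i ∈ V i) :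
    (univ.image f).card = d := by
  rw [card_image_of_injective, card_univ, Fintype.card_fin]
  intro i j hij
  by_contra h
  exact disjoint_left.mp (hdisj i j h) (hf i) (hij ▸ hf j)

open Finset in
theorem image_transversal_inter {n d : ℕ} {V : Fin d → Finset (Fin n)}
    (hdisj : ∀ i j, i ≠ j → Disjoint (V i) (V j)) {f : Fin d → Fin n} (hf : ∀ i, f i ∈ V i)
    (i : Fin d) : univ.image f ∩ V i = {f i} := by
  ext x
  simp only [mem_inter, mem_image, mem_univ, true_and, mem_singleton]
  constructor
  · rintro ⟨⟨j, rfl⟩, hx⟩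
    by_contra h
    have hji : j ≠ i := fun h' => h (h' ▸ rfl)
    exact disjoint_left.mp (hdisj j i hji) (hf j) hx
  · rintro rfl
    exact ⟨⟨i, rfl⟩, hf i⟩

open Finset in
theorem image_transversal_mem_edges {n d : ℕ} {V : Fin d → Finset (Fin n)}
    (hdisj : ∀ i j, i ≠ j → Disjoint (V i) (V j)) {f : Fin d → Fin n} (hf : ∀ i, f i ∈ V i) :
    univ.image f ∈ completeDPartiteEdges V := by
  simp only [completeDPartiteEdges, mem_filter, mem_powersetCard, subset_univ, true_and]
  exact ⟨card_image_transversal hdisj hf, fun i => by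
    rw [image_transversal_inter hdisj hf, card_singleton]⟩

theorem le_card_of_mem_charPoset_completeDPartite {n d : ℕ} {V : Fin d → Finset (Fin n)}
    {S : Finset (Fin n)} (hS : S ∈ charPoset (completeDPartiteEdges V)) : d ≤ S.card := by
  simp only [charPoset, completeDPartiteEdges, Finset.mem_filter, Finset.mem_powersetCard] at hS
  obtain ⟨-, e, ⟨⟨-, he⟩, -⟩, heS⟩ := hS
  exact he ▸ Finset.card_le_card heS

/-- The partition of `P` into its singletons. -/
theorem isIntervalPartition_image_diag {n : ℕ} (P : Finset (Finset (Fin n))) :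
    IsIntervalPartition P (P.image fun S => (S, S)) := by
  refine ⟨?_, ?_, ?_⟩
  · intro p hp
    obtain ⟨S, -, rfl⟩ := Finset.mem_image.mp hp
    exact subset_rfl
  · intro p hp T h1 h2
    obtain ⟨S, hS, rfl⟩ := Finset.mem_image.mp hp
    rwa [← Finset.Subset.antisymm h1 h2]
  · intro S hS
    refine ⟨(S, S), ⟨Finset.mem_image_of_mem _ hS, subset_rfl, subset_rfl⟩, ?_⟩
    rintro p ⟨hp, h1, h2⟩
    obtain ⟨T, -, rfl⟩ := Finset.mem_image.mp hp
    have hTS : T = S := Finset.Subset.antisymm h1 h2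
    rw [hTS]

open Finset in
/-- In an interval partition, the interval through a transversal has this transversal as its
bottom. -/
theorem IsIntervalPartition.exists_fst_eq_image_transversal {n d : ℕ}
    {V : Fin d → Finset (Fin n)} (hdisj : ∀ i j, i ≠ j → Disjoint (V i) (V j))
    {D : Finset (Finset (Fin n) × Finset (Fin n))}
    (hD : IsIntervalPartition (charPoset (completeDPartiteEdges V)) D)
    {f : Fin d → Fin n} (hf : ∀ i, f i ∈ V i) : ∃ p ∈ D, p.1 = univ.image f := by
  have hmem : univ.image f ∈ charPoset (completeDPartiteEdges V) :=
    mem_filter.mpr ⟨mem_univ _, _, image_transversal_mem_edges hdisj hf, subset_rfl⟩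
  obtain ⟨p, ⟨hp, h1, -⟩, -⟩ := hD.2.2 _ hmem
  refine ⟨p, hp, eq_of_subset_of_card_le h1 ?_⟩
  rw [card_image_transversal hdisj hf]
  exact le_card_of_mem_charPoset_completeDPartite (hD.2.1 p hp p.1 subset_rfl (hD.1 p hp))

open Finset in
/-- If an interval partition has all tops of size at least `m`, then `m - d` is at most half of
the number of ways to add an element to an edge: adding `x ∈ V i` to the transversal `f` gives the
same set as adding `f i` to the transversal obtained by replacing `f i` with `x`, and this set lies
in the interval of at most one of the two. -/
theorem IsIntervalPartition.two_mul_sub_le {n d : ℕ} {V : Fin d → Finset (Fin n)}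
    (hdisj : ∀ i j, i ≠ j → Disjoint (V i) (V j)) (hcover : ∀ x : Fin n, ∃ i, x ∈ V i)
    (hne : ∀ i, (V i).Nonempty) {D : Finset (Finset (Fin n) × Finset (Fin n))}
    (hD : IsIntervalPartition (charPoset (completeDPartiteEdges V)) D) {m : ℕ}
    (hm : ∀ p ∈ D, m ≤ p.2.card) : 2 * (m - d) ≤ ∑ i, ((V i).card - 1) := by
  have hex : ∀ f : Fin d → Fin n, (∀ i, f i ∈ V i) → ∃ p ∈ D, p.1 = univ.image f :=
    fun f hf => hD.exists_fst_eq_image_transversal hdisj hf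
  choose! p hpD hp1 using hex
  set F : Finset (Fin d → Fin n) := Fintype.piFinset V with hF
  let ext (f : Fin d → Fin n) : Finset (Σ _ : Fin d, Fin n) :=
    univ.sigma fun i => (V i).erase (f i)
  let all : Finset (Σ _ : Fin d → Fin n, Σ _ : Fin d, Fin n) := F.sigma ext
  let good : Finset (Σ _ : Fin d → Fin n, Σ _ : Fin d, Fin n) :=
    F.sigma fun f => (ext f).filter fun t => t.2 ∈ (p f).2
  let swap : (Σ _ : Fin d → Fin n, Σ _ : Fin d, Fin n) → Σ _ : Fin d → Fin n, Σ _ : Fin d, Fin n :=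
    fun t => ⟨Function.update t.1 t.2.1 t.2.2, t.2.1, t.1 t.2.1⟩
  have hall : ∀ f i x, (⟨f, i, x⟩ : Σ _ : Fin d → Fin n, Σ _ : Fin d, Fin n) ∈ all ↔
      (∀ j, f j ∈ V j) ∧ x ≠ f i ∧ x ∈ V i := by
    intro f i x
    simp [all, ext, hF]
  have hgood : ∀ f i x, (⟨f, i, x⟩ : Σ _ : Fin d → Fin n, Σ _ : Fin d, Fin n) ∈ good ↔
      ((∀ j, f j ∈ V j) ∧ x ≠ f i ∧ x ∈ V i) ∧ x ∈ (p f).2 := by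
    intro f i x
    simp [good, ext, hF, and_assoc]
  have hswap : ∀ t, swap (swap t) = t := by
    rintro ⟨f, i, x⟩
    simp [swap]
  have hswap_mem : ∀ t ∈ all, swap t ∈ all := by
    rintro ⟨f, i, x⟩ ht
    rw [hall] at ht
    obtain ⟨hf, hx, hxV⟩ := ht
    refine (hall _ _ _).mpr ⟨fun j => ?_, ?_, hf i⟩
    · by_cases h : j = i
      · subst h; simpa using hxV
      · simpa [h] using hf j
    · simpa using hx.symm
  have hgood_sub : good ⊆ all := by
    rintro ⟨f, i, x⟩ ht
    exact (hall _ _ _).mpr ((hgood _ _ _).mp ht).1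
  have hdisj' : Disjoint good (good.image swap) := by
    rw [disjoint_left]
    rintro t ht ht'
    obtain ⟨s, hs, rfl⟩ := mem_image.mp ht'
    obtain ⟨f, i, x⟩ := s
    obtain ⟨⟨hf, hx, hxV⟩, hxp⟩ := (hgood _ _ _).mp hs
    obtain ⟨⟨hg, -, -⟩, hyp⟩ := (hgood _ _ _).mp ht
    change ∀ j, Function.update f i x j ∈ V j at hg
    change f i ∈ (p (Function.update f i x)).2 at hyp
    set g := Function.update f i x with hgdef
    have hgi : g i = x := by simp [hgdef]
    have hf2 : univ.image f ⊆ (p f).2 := hp1 f hf ▸ hD.1 _ (hpD f hf)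
    have hg2 : univ.image g ⊆ (p g).2 := hp1 g hg ▸ hD.1 _ (hpD g hg)
    have hgf : univ.image g ⊆ insert x (univ.image f) := by
      rintro _ hy
      obtain ⟨j, -, rfl⟩ := mem_image.mp hy
      by_cases h : j = i
      · subst h; simp [hgi]
      · simp [hgdef, h]
    have hfg : insert x (univ.image f) ⊆ insert (f i) (univ.image g) := by
      rw [insert_subset_iff]
      refine ⟨mem_insert_of_mem (hgi ▸ mem_image_of_mem g (mem_univ i)), ?_⟩
      rintro _ hy
      obtain ⟨j, -, rfl⟩ := mem_image.mp hy
      by_cases h : j = i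
      · subst h; exact mem_insert_self _ _
      · refine mem_insert_of_mem (mem_image.mpr ⟨j, mem_univ j, ?_⟩)
        simp [hgdef, h]
    have hSf : insert x (univ.image f) ⊆ (p f).2 := insert_subset hxp hf2
    have hSg : insert x (univ.image f) ⊆ (p g).2 := hfg.trans (insert_subset hyp hg2)
    have hfS : (p f).1 ⊆ insert x (univ.image f) := hp1 f hf ▸ subset_insert _ _
    have hgS : (p g).1 ⊆ insert x (univ.image f) := hp1 g hg ▸ hgf
    have hpeq : p f = p g :=
      (hD.2.2 _ (hD.2.1 _ (hpD f hf) _ hfS hSf)).unique ⟨hpD f hf, hfS, hSf⟩ ⟨hpD g hg, hgS, hSg⟩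
    have himage : univ.image f = univ.image g := by rw [← hp1 f hf, ← hp1 g hg, hpeq]
    have hxf : x ∈ univ.image f ∩ V i :=
      mem_inter.mpr ⟨himage ▸ hgi ▸ mem_image_of_mem g (mem_univ i), hxV⟩
    rw [image_transversal_inter hdisj hf, mem_singleton] at hxf
    exact hx hxf
  have hcard : good.card + good.card ≤ all.card := by
    have himg : (good.image swap).card = good.card :=
      card_image_of_injective _ (Function.LeftInverse.injective hswap)
    calc good.card + good.card = (good ∪ good.image swap).card := by
          rw [card_union_of_disjoint hdisj', himg]
      _ ≤ all.card := card_le_card (union_subset hgood_sub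
          (image_subset_iff.mpr fun t ht => hswap_mem t (hgood_sub ht)))
  have hcard_all : all.card = F.card * ∑ i, ((V i).card - 1) := by
    rw [card_sigma, sum_const_nat]
    intro f hf
    rw [card_sigma]
    exact sum_congr rfl fun i _ => card_erase_of_mem (Fintype.mem_piFinset.mp hf i)
  have hcard_good : F.card * (m - d) ≤ good.card := by
    rw [card_sigma, ← smul_eq_mul]
    refine card_nsmul_le_sum _ _ _ fun f hfF => ?_
    have hf := Fintype.mem_piFinset.mp hfF
    have hsub : (p f).2 \ univ.image f ⊆
        ((ext f).filter fun t => t.2 ∈ (p f).2).image Sigma.snd := by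
      intro x hx
      obtain ⟨hx2, hxf⟩ := mem_sdiff.mp hx
      obtain ⟨i, hi⟩ := hcover x
      refine mem_image.mpr ⟨⟨i, x⟩, mem_filter.mpr ⟨?_, hx2⟩, rfl⟩
      refine mem_sigma.mpr ⟨mem_univ i, mem_erase.mpr ⟨?_, hi⟩⟩
      intro hxi
      exact hxf (mem_image.mpr ⟨i, mem_univ i, hxi.symm⟩)
    calc m - d ≤ (p f).2.card - (univ.image f).card := by
          rw [card_image_transversal hdisj hf]
          exact Nat.sub_le_sub_right (hm _ (hpD f hf)) d
      _ ≤ ((p f).2 \ univ.image f).card := le_card_sdiff _ _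
      _ ≤ _ := (card_le_card hsub).trans card_image_le
  have hFpos : 0 < F.card := card_pos.mpr (Fintype.piFinset_nonempty.mpr hne)
  refine Nat.le_of_mul_le_mul_left ?_ hFpos
  rw [← hcard_all]
  calc F.card * (2 * (m - d)) = F.card * (m - d) + F.card * (m - d) := by ring
    _ ≤ all.card := (add_le_add hcard_good hcard_good).trans hcard

/-- Let `[n] = V 0 ∪ ⋯ ∪ V (d-1)` be a partition into `d` disjoint blocks with `|V i| = r i`
and `2 ≤ r 0 ≤ ⋯ ≤ r (d-1)`, and let `P` be the characteristic poset of the `d`-uniform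
complete `d`-partite clutter on this partition. Then
`d ≤ sdepth P ≤ d + Σ_i (r i − 1)/2`. -/
theorem sdepth_complete_d_partite_bounds {n d : ℕ} (hd : 1 ≤ d)
    (V : Fin d → Finset (Fin n))
    (hV_disjoint : ∀ i j, i ≠ j → Disjoint (V i) (V j))
    (hV_cover : ∀ x : Fin n, ∃ i, x ∈ V i)
    (r : Fin d → ℕ) (hr : ∀ i, r i = (V i).card)
    (hr2 : ∀ i, 2 ≤ r i) (hr_mono : ∀ i j, i ≤ j → r i ≤ r j) :
    d ≤ posetSdepth (charPoset (completeDPartiteEdges V)) ∧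
      (posetSdepth (charPoset (completeDPartiteEdges V)) : ℚ) ≤
        d + ∑ i, ((r i : ℚ) - 1) / 2 := by
  set A := {m | ∃ D, IsIntervalPartition (charPoset (completeDPartiteEdges V)) D ∧
    ∀ p ∈ D, m ≤ p.2.card} with hA
  have hne : ∀ i, (V i).Nonempty := fun i =>
    Finset.card_pos.mp (by have := hr2 i; rw [hr i] at this; omega)
  have hbound : ∀ m ∈ A, 2 * (m - d) ≤ ∑ i, ((V i).card - 1) := by
    rintro m ⟨D, hD, hm⟩
    exact hD.two_mul_sub_le hV_disjoint hV_cover hne hm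
  have hdA : d ∈ A := by
    refine ⟨_, isIntervalPartition_image_diag _, fun p hp => ?_⟩
    obtain ⟨S, hS, rfl⟩ := Finset.mem_image.mp hp
    exact le_card_of_mem_charPoset_completeDPartite hS
  have hbdd : BddAbove A :=
    ⟨d + ∑ i, ((V i).card - 1), fun m hm => by have := hbound m hm; omega⟩
  refine ⟨le_csSup hbdd hdA, ?_⟩
  have hle := hbound _ (Nat.sSup_mem ⟨d, hdA⟩ hbdd)
  change 2 * (posetSdepth (charPoset (completeDPartiteEdges V)) - d) ≤ _ at hle
  have hle' : 2 * posetSdepth (charPoset (completeDPartiteEdges V)) ≤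
      2 * d + ∑ i, ((V i).card - 1) := by omega
  have hsum : ((∑ i, ((V i).card - 1) : ℕ) : ℚ) = ∑ i, ((r i : ℚ) - 1) := by
    rw [Nat.cast_sum]
    refine Finset.sum_congr rfl fun i _ => ?_
    rw [← hr i, Nat.cast_sub (by have := hr2 i; omega), Nat.cast_one]
  have hq : 2 * (posetSdepth (charPoset (completeDPartiteEdges V)) : ℚ) ≤
      2 * d + ∑ i, ((r i : ℚ) - 1) := by
    rw [← hsum]
    exact_mod_cast hle'
  rw [← Finset.sum_div]
  linarith
end

section
/- Let C be a d-uniform clutter on [n] (d ≥ 1) that is integral, i.e., every extreme point of its set covering polyhedron Q = {x ∈ ℝ^n : x ≥ 0 and Σ_{i∈e} x_i ≥ 1 for every edge e} has integer coordinates. Then there exists a minimal vertex cover V_1 of C such that |e ∩ V_1| = 1 for every edge e of C. -/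
/-- The set covering polyhedron of a clutter with edge set `E` on `[n]`:
`Q = {x ∈ ℝ^n : x ≥ 0 and Σ_{i ∈ e} x_i ≥ 1 for every edge e}`. -/
def coveringPolyhedron {n : ℕ} (E : Finset (Finset (Fin n))) : Set (Fin n → ℝ) :=
  {x | (∀ i, 0 ≤ x i) ∧ ∀ e ∈ E, 1 ≤ ∑ i ∈ e, x i}

/-- A vertex cover of the clutter with edge set `E`: a set of vertices meeting every edge. -/
def IsVertexCover {n : ℕ} (E : Finset (Finset (Fin n))) (W : Finset (Fin n)) : Prop :=
  ∀ e ∈ E, (e ∩ W).Nonempty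

/-- A minimal vertex cover: a vertex cover no proper subset of which is a vertex cover. -/
def IsMinimalVertexCover {n : ℕ} (E : Finset (Finset (Fin n))) (W : Finset (Fin n)) : Prop :=
  IsVertexCover E W ∧ ∀ W' ⊂ W, ¬ IsVertexCover E W'

/-- A clutter is integral if every extreme point of its set covering polyhedron has
integer coordinates. -/
def IsIntegralClutter {n : ℕ} (E : Finset (Finset (Fin n))) : Prop :=
  ∀ x ∈ Set.extremePoints ℝ (coveringPolyhedron E), ∀ i, ∃ z : ℤ, x i = (z : ℝ)

/-- The face of the set covering polyhedron on which every edge inequality is tight and every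
coordinate outside all edges vanishes. -/
def tightFace {n : ℕ} (E : Finset (Finset (Fin n))) : Set (Fin n → ℝ) :=
  {x | (∀ i, 0 ≤ x i) ∧ (∀ e ∈ E, ∑ i ∈ e, x i = 1) ∧ ∀ i, (∀ e ∈ E, i ∉ e) → x i = 0}

theorem tightFace_subset_Icc {n : ℕ} (E : Finset (Finset (Fin n))) :
    tightFace E ⊆ Set.Icc 0 1 := by
  rintro x ⟨h0, h1, h2⟩
  refine ⟨h0, fun i => ?_⟩
  by_cases hi : ∃ e ∈ E, i ∈ e
  · obtain ⟨e, he, hie⟩ := hi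
    exact (Finset.single_le_sum (fun j _ => h0 j) hie).trans (h1 e he).le
  · push Not at hi
    simp [h2 i hi]

theorem isCompact_tightFace {n : ℕ} (E : Finset (Finset (Fin n))) :
    IsCompact (tightFace E) := by
  refine isCompact_Icc.of_isClosed_subset ?_ (tightFace_subset_Icc E)
  simp only [tightFace, Set.ofPred_and, Set.ofPred_forall]
  refine (isClosed_iInter fun i => isClosed_le (by fun_prop) (by fun_prop)).inter
    ((isClosed_iInter fun e => isClosed_iInter fun _ =>
      isClosed_eq (by fun_prop) (by fun_prop)).inter
    (isClosed_iInter fun i => isClosed_iInter fun _ => isClosed_eq (by fun_prop) (by fun_prop)))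

theorem tightFace_nonempty {n d : ℕ} (hd : 1 ≤ d) (E : Finset (Finset (Fin n)))
    (h_uniform : ∀ e ∈ E, e.card = d) : (tightFace E).Nonempty := by
  classical
  refine ⟨fun i => if ∃ e ∈ E, i ∈ e then (d : ℝ)⁻¹ else 0, fun i => ?_, fun e he => ?_,
    fun i hi => ?_⟩
  · dsimp only
    split_ifs <;> positivity
  · rw [Finset.sum_congr rfl fun i hi => if_pos ⟨e, he, hi⟩, Finset.sum_const, h_uniform e he,
      nsmul_eq_mul, mul_inv_cancel₀]
    exact_mod_cast (by lia : d ≠ 0)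
  · exact if_neg fun ⟨e, he, hie⟩ => hi e he hie

theorem isExtreme_tightFace {n : ℕ} (E : Finset (Finset (Fin n))) :
    IsExtreme ℝ (coveringPolyhedron E) (tightFace E) := by
  refine ⟨fun x hx => ⟨hx.1, fun e he => (hx.2.1 e he).ge⟩, ?_⟩
  rintro y ⟨hy0, hy1⟩ z ⟨hz0, hz1⟩ x ⟨-, hx1, hx2⟩ ⟨a, b, ha, hb, hab, rfl⟩
  refine ⟨hy0, fun e he => ?_, fun i hi => ?_⟩
  · have h := hx1 e he
    simp only [Pi.add_apply, Pi.smul_apply, smul_eq_mul, Finset.sum_add_distrib,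
      ← Finset.mul_sum] at h
    refine le_antisymm ?_ (hy1 e he)
    nlinarith [mul_le_mul_of_nonneg_left (hz1 e he) hb.le]
  · have h := hx2 i hi
    simp only [Pi.add_apply, Pi.smul_apply, smul_eq_mul] at h
    refine le_antisymm ?_ (hy0 i)
    nlinarith [mul_nonneg hb.le (hz0 i)]

theorem exists_integral_mem_tightFace {n d : ℕ} (hd : 1 ≤ d) (E : Finset (Finset (Fin n)))
    (h_uniform : ∀ e ∈ E, e.card = d) (h_integral : IsIntegralClutter E) :
    ∃ x ∈ tightFace E, ∀ i, x i = 0 ∨ x i = 1 := by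
  obtain ⟨x, hx⟩ := (isCompact_tightFace E).extremePoints_nonempty
    (tightFace_nonempty hd E h_uniform)
  refine ⟨x, hx.1, fun i => ?_⟩
  obtain ⟨z, hz⟩ := h_integral x
    ((isExtreme_tightFace E).extremePoints_subset_extremePoints hx) i
  have h0 : 0 ≤ x i := (tightFace_subset_Icc E hx.1).1 i
  have h1 : x i ≤ 1 := (tightFace_subset_Icc E hx.1).2 i
  rw [hz] at h0 h1 ⊢
  norm_cast at h0 h1 ⊢
  lia

/-- If `C` is an integral `d`-uniform clutter on `[n]` (`d ≥ 1`), then there exists a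
minimal vertex cover of `C` intersecting every edge of `C` in exactly one vertex. -/
theorem exists_minimal_cover_meeting_each_edge_once {n d : ℕ} (hd : 1 ≤ d)
    (E : Finset (Finset (Fin n)))
    (h_uniform : ∀ e ∈ E, e.card = d)
    (h_antichain : ∀ e ∈ E, ∀ f ∈ E, e ⊆ f → e = f)
    (h_integral : IsIntegralClutter E) :
    ∃ W : Finset (Fin n), IsMinimalVertexCover E W ∧ ∀ e ∈ E, (e ∩ W).card = 1 := by
  classical
  obtain ⟨x, ⟨_, hx1, hx2⟩, hx⟩ := exists_integral_mem_tightFace hd E h_uniform h_integral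
  let W : Finset (Fin n) := Finset.univ.filter fun i => x i = 1
  have h_card : ∀ e ∈ E, (e ∩ W).card = 1 := by
    intro e he
    have h : ∑ i ∈ e, x i = ((e ∩ W).card : ℝ) := by
      rw [Finset.card_eq_sum_ones, ← Finset.filter_mem_eq_inter, Finset.sum_filter]
      push_cast
      refine Finset.sum_congr rfl fun i _ => ?_
      rcases hx i with hi | hi <;> simp [W, hi]
    exact_mod_cast h.symm.trans (hx1 e he)
  refine ⟨W, ⟨fun e he => Finset.card_pos.mp (by simp [h_card e he]), fun W' hW' h_cover => ?_⟩,
    h_card⟩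
  obtain ⟨i, hiW, hiW'⟩ := Finset.exists_of_ssubset hW'
  have hi : x i = 1 := by simpa [W] using hiW
  obtain ⟨e, he, hie⟩ : ∃ e ∈ E, i ∈ e := by
    by_contra! h
    simp [hx2 i h] at hi
  obtain ⟨j, hj⟩ := h_cover e he
  rw [Finset.mem_inter] at hj
  have hij : j = i := Finset.card_le_one.mp (h_card e he).le j
    (Finset.mem_inter.mpr ⟨hj.1, hW'.subset hj.2⟩) i (Finset.mem_inter.mpr ⟨hie, hiW⟩)
  exact hiW' (hij ▸ hj.2)
end

section
/- Let C be a clutter on [n] with at least one edge, and let Q = {x ∈ ℝ^n : x ≥ 0 and Σ_{i∈e} x_i ≥ 1 for every edge e} be its set covering polyhedron. A vector α ∈ ℝ^n with integer coordinates is an extreme point of Q if and only if α = Σ_{i∈W} e_i is the 0–1 indicator vector of some minimal vertex cover W of C (here e_i denotes the i-th standard unit vector of ℝ^n). -/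
/-- The covering polyhedron is closed under increasing coordinates. -/
theorem coveringPolyhedron_mono {n : ℕ} {E : Finset (Finset (Fin n))} {x y : Fin n → ℝ}
    (hx : x ∈ coveringPolyhedron E) (hxy : x ≤ y) : y ∈ coveringPolyhedron E :=
  ⟨fun i => (hx.1 i).trans (hxy i), fun e he =>
    (hx.2 e he).trans (Finset.sum_le_sum fun i _ => hxy i)⟩

/-- Extreme points of the covering polyhedron are minimal for the coordinatewise order. -/
theorem eq_of_le_of_mem_extremePoints_coveringPolyhedron {n : ℕ}
    {E : Finset (Finset (Fin n))} {x y : Fin n → ℝ}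
    (hx : x ∈ Set.extremePoints ℝ (coveringPolyhedron E))
    (hy : y ∈ coveringPolyhedron E) (hyx : y ≤ x) : y = x := by
  rw [mem_extremePoints_iff_left] at hx
  have hz : x + (x - y) ∈ coveringPolyhedron E :=
    coveringPolyhedron_mono hx.1 fun i => by
      have := hyx i
      simp only [Pi.add_apply, Pi.sub_apply]
      linarith
  refine hx.2 y hy _ hz ⟨1 / 2, 1 / 2, by norm_num, by norm_num, by norm_num, ?_⟩
  ext i
  simp only [Pi.add_apply, Pi.sub_apply, Pi.smul_apply, smul_eq_mul]
  ring

/-- The indicator vector of a vertex cover lies in the covering polyhedron. -/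
theorem IsVertexCover.indicator_mem_coveringPolyhedron {n : ℕ}
    {E : Finset (Finset (Fin n))} {W : Finset (Fin n)} (hW : IsVertexCover E W) :
    (fun i => if i ∈ W then (1 : ℝ) else 0) ∈ coveringPolyhedron E := by
  refine ⟨fun i => by positivity, fun e he => ?_⟩
  rw [Finset.sum_ite_mem, Finset.sum_const, nsmul_eq_mul, mul_one]
  exact_mod_cast (hW e he).card_pos

/-- Every vertex of a minimal vertex cover is the only vertex of the cover in some edge. -/
theorem IsMinimalVertexCover.exists_inter_eq_singleton {n : ℕ}
    {E : Finset (Finset (Fin n))} {W : Finset (Fin n)} (hW : IsMinimalVertexCover E W)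
    {i : Fin n} (hi : i ∈ W) : ∃ e ∈ E, e ∩ W = {i} := by
  have h := hW.2 _ (Finset.erase_ssubset hi)
  unfold IsVertexCover at h
  push Not at h
  obtain ⟨e, he, h⟩ := h
  rw [Finset.inter_erase, Finset.erase_eq_empty_iff] at h
  exact ⟨e, he, h.resolve_left (hW.1 e he).ne_empty⟩

/-- A point of the covering polyhedron that vanishes off a minimal vertex cover is at least
the indicator vector of the cover. -/
theorem IsMinimalVertexCover.one_le_of_mem_coveringPolyhedron {n : ℕ}
    {E : Finset (Finset (Fin n))} {W : Finset (Fin n)} (hW : IsMinimalVertexCover E W)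
    {x : Fin n → ℝ} (hx : x ∈ coveringPolyhedron E) (hx0 : ∀ j ∉ W, x j = 0)
    {i : Fin n} (hi : i ∈ W) : 1 ≤ x i := by
  obtain ⟨e, he, h⟩ := hW.exists_inter_eq_singleton hi
  calc 1 ≤ ∑ j ∈ e, x j := hx.2 e he
    _ = ∑ j ∈ e ∩ W, x j := (Finset.sum_subset Finset.inter_subset_left fun j hj hjW =>
        hx0 j fun hj' => hjW (Finset.mem_inter.2 ⟨hj, hj'⟩)).symm
    _ = x i := by rw [h, Finset.sum_singleton]

/-- The indicator vector of a minimal vertex cover is an extreme point of the covering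
polyhedron. -/
theorem IsMinimalVertexCover.indicator_mem_extremePoints {n : ℕ}
    {E : Finset (Finset (Fin n))} {W : Finset (Fin n)} (hW : IsMinimalVertexCover E W) :
    (fun i => if i ∈ W then (1 : ℝ) else 0) ∈
      Set.extremePoints ℝ (coveringPolyhedron E) := by
  rw [mem_extremePoints_iff_left]
  refine ⟨hW.1.indicator_mem_coveringPolyhedron, ?_⟩
  rintro x hx y hy ⟨a, b, ha, hb, hab, h⟩
  have hc (j : Fin n) : a * x j + b * y j = if j ∈ W then 1 else 0 := congrFun h j
  have hx0 : ∀ j ∉ W, x j = 0 := fun j hj => by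
    have := hc j
    rw [if_neg hj] at this
    nlinarith [hx.1 j, mul_nonneg ha.le (hx.1 j), mul_nonneg hb.le (hy.1 j)]
  have hy0 : ∀ j ∉ W, y j = 0 := fun j hj => by
    have := hc j
    rw [if_neg hj] at this
    nlinarith [hy.1 j, mul_nonneg ha.le (hx.1 j), mul_nonneg hb.le (hy.1 j)]
  ext i
  by_cases hi : i ∈ W
  · have hxi := hW.one_le_of_mem_coveringPolyhedron hx hx0 hi
    have hyi := hW.one_le_of_mem_coveringPolyhedron hy hy0 hi
    have hci := hc i
    rw [if_pos hi] at hci ⊢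
    nlinarith [mul_nonneg hb.le (sub_nonneg.2 hyi)]
  · rw [if_neg hi, hx0 i hi]

/-- Let `C` be a clutter on `[n]` with at least one edge and let `Q` be its set covering
polyhedron. A vector `α ∈ ℝ^n` with integer coordinates is an extreme point of `Q` if and
only if `α` is the 0–1 indicator vector of some minimal vertex cover `W` of `C`. -/
theorem integral_extreme_point_iff_minimal_cover {n : ℕ}
    (E : Finset (Finset (Fin n))) (hE : E.Nonempty)
    (h_nonempty_edges : ∀ e ∈ E, e.Nonempty)
    (h_antichain : ∀ e ∈ E, ∀ f ∈ E, e ⊆ f → e = f)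
    (α : Fin n → ℝ) (hα : ∀ i, ∃ z : ℤ, α i = (z : ℝ)) :
    α ∈ Set.extremePoints ℝ (coveringPolyhedron E) ↔
      ∃ W : Finset (Fin n), IsMinimalVertexCover E W ∧
        α = fun i => if i ∈ W then (1 : ℝ) else 0 := by
  refine ⟨fun h => ?_, fun ⟨W, hW, h⟩ => h ▸ hW.indicator_mem_extremePoints⟩
  let W : Finset (Fin n) := {i | α i ≠ 0}
  have hcover : IsVertexCover E W := fun e he => by
    obtain ⟨i, hi, hi0⟩ := Finset.exists_ne_zero_of_sum_ne_zero
      (zero_lt_one.trans_le (h.1.2 e he)).ne'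
    exact ⟨i, by simp [W, hi, hi0]⟩
  have hle : (fun i => if i ∈ W then (1 : ℝ) else 0) ≤ α := fun i => by
    have h0 := h.1.1 i
    dsimp only
    split_ifs with hi
    · have hi0 : α i ≠ 0 := by simpa [W] using hi
      obtain ⟨z, hz⟩ := hα i
      have hpos := lt_of_le_of_ne h0 hi0.symm
      rw [hz] at hpos ⊢
      exact_mod_cast hpos
    · exact h0
  have hW := eq_of_le_of_mem_extremePoints_coveringPolyhedron h
    hcover.indicator_mem_coveringPolyhedron hle
  refine ⟨W, ⟨hcover, fun W' hW' hcover' => ?_⟩, hW.symm⟩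
  rw [← hW] at h
  have heq := eq_of_le_of_mem_extremePoints_coveringPolyhedron h
    hcover'.indicator_mem_coveringPolyhedron fun i => by
      by_cases hi : i ∈ W'
      · simp [hi, hW'.subset hi]
      · simp only [hi, if_false]
        positivity
  obtain ⟨i, hi, hi'⟩ := Finset.exists_of_ssubset hW'
  simpa [hi, hi'] using congrFun heq i
end

section
/- Let C be an integral d-uniform clutter on [n] whose edges cover [n], and suppose its d-partite decomposition [n] = V_1 ∪ ⋯ ∪ V_d into pairwise disjoint minimal vertex covers is complete, i.e., every d-element subset e ⊆ [n] with |e ∩ V_i| = 1 for all i is an edge of C. Let r_i = |V_i| and let P = {C ⊆ [n] : C contains some edge of C} be the characteristic poset. Then d ≤ sdepth(P) ≤ d + Σ_{i=1}^{d} (r_i − 1)/2. -/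
section IntervalPartition

variable {n : ℕ}

lemma mem_charPoset {E : Finset (Finset (Fin n))} {S : Finset (Fin n)} :
    S ∈ charPoset E ↔ ∃ e ∈ E, e ⊆ S := by
  simp [charPoset]

lemma subset_charPoset (E : Finset (Finset (Fin n))) : E ⊆ charPoset E :=
  fun e he => mem_charPoset.2 ⟨e, he, subset_rfl⟩

/-- Every family of sets is partitioned by its degenerate intervals `[S, S]`. -/
lemma isIntervalPartition_diag (P : Finset (Finset (Fin n))) :
    IsIntervalPartition P (P.image fun S => (S, S)) := by
  refine ⟨?_, ?_, ?_⟩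
  · simp
  · intro p hp S h₁ h₂
    obtain ⟨T, hT, rfl⟩ := Finset.mem_image.1 hp
    obtain rfl : T = S := h₁.antisymm h₂
    exact hT
  · intro S hS
    refine ⟨(S, S), ⟨Finset.mem_image_of_mem _ hS, subset_rfl, subset_rfl⟩, ?_⟩
    rintro p ⟨hp, h₁, h₂⟩
    obtain ⟨T, hT, rfl⟩ := Finset.mem_image.1 hp
    obtain rfl : T = S := h₁.antisymm h₂
    rfl

lemma bddAbove_sdepth {P : Finset (Finset (Fin n))} (hP : P.Nonempty) :
    BddAbove {m | ∃ D, IsIntervalPartition P D ∧ ∀ p ∈ D, m ≤ p.2.card} := by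
  refine ⟨n, ?_⟩
  rintro m ⟨D, hD, hm⟩
  obtain ⟨S, hS⟩ := hP
  obtain ⟨p, ⟨hp, -, -⟩, -⟩ := hD.2.2 S hS
  simpa using (hm p hp).trans (Finset.card_le_univ p.2)

lemma le_posetSdepth {P : Finset (Finset (Fin n))} (hP : P.Nonempty) {d : ℕ}
    (h : ∀ S ∈ P, d ≤ S.card) : d ≤ posetSdepth P := by
  refine le_csSup (bddAbove_sdepth hP) ⟨_, isIntervalPartition_diag P, ?_⟩
  simpa using h

lemma exists_isIntervalPartition_posetSdepth {P : Finset (Finset (Fin n))} (hP : P.Nonempty) :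
    ∃ D, IsIntervalPartition P D ∧ ∀ p ∈ D, posetSdepth P ≤ p.2.card := by
  refine Nat.sSup_mem (s := {m | ∃ D, IsIntervalPartition P D ∧ ∀ p ∈ D, m ≤ p.2.card})
    ?_ (bddAbove_sdepth hP)
  exact ⟨0, _, isIntervalPartition_diag P, fun _ _ => Nat.zero_le _⟩

/-- In an interval partition of the characteristic poset of a clutter, every edge is the bottom
of an interval. -/
lemma IsIntervalPartition.exists_top {E : Finset (Finset (Fin n))}
    (h_antichain : ∀ e ∈ E, ∀ f ∈ E, e ⊆ f → e = f)
    {D : Finset (Finset (Fin n) × Finset (Fin n))} (hD : IsIntervalPartition (charPoset E) D)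
    {e : Finset (Fin n)} (he : e ∈ E) : ∃ T, (e, T) ∈ D := by
  obtain ⟨p, ⟨hp, h₁, -⟩, -⟩ := hD.2.2 e (subset_charPoset E he)
  obtain ⟨f, hf, hfp⟩ := mem_charPoset.1 (hD.2.1 p hp p.1 subset_rfl (hD.1 p hp))
  obtain rfl := h_antichain f hf e he (hfp.trans h₁)
  have hpf : p = (f, p.2) := Prod.ext (h₁.antisymm hfp) rfl
  exact ⟨p.2, hpf ▸ hp⟩

/-- The intervals of a partition whose bottoms are edges contain many sets of size `d + 1`. -/
lemma IsIntervalPartition.card_mul_le {E : Finset (Finset (Fin n))} {d k : ℕ}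
    (h_uniform : ∀ e ∈ E, e.card = d)
    (h_antichain : ∀ e ∈ E, ∀ f ∈ E, e ⊆ f → e = f)
    {D : Finset (Finset (Fin n) × Finset (Fin n))} (hD : IsIntervalPartition (charPoset E) D)
    (hk : ∀ p ∈ D, d + k ≤ p.2.card) :
    E.card * k ≤ ((charPoset E).filter fun S => S.card = d + 1).card := by
  choose! T hT using fun e (he : e ∈ E) => hD.exists_top h_antichain he
  have hsub : ∀ e ∈ E, e ⊆ T e := fun e he => hD.1 _ (hT e he)
  have hcard : ∀ e ∈ E, k ≤ ((T e \ e).image fun x => insert x e).card := by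
    intro e he
    rw [Finset.card_image_of_injOn, Finset.card_sdiff_of_subset (hsub e he), h_uniform e he]
    · have := hk _ (hT e he)
      simp only at this
      omega
    · intro x hx y hy hxy
      simp only [Finset.coe_sdiff, Set.mem_sdiff, Finset.mem_coe] at hx hy
      exact (Finset.insert_inj hx.2).1 hxy
  have hmem : ∀ e ∈ E, ∀ S ∈ (T e \ e).image (fun x => insert x e),
      e ⊆ S ∧ S ⊆ T e ∧ S.card = d + 1 := by
    intro e he S hS
    obtain ⟨x, hx, rfl⟩ := Finset.mem_image.1 hS
    rw [Finset.mem_sdiff] at hx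
    exact ⟨Finset.subset_insert _ _, Finset.insert_subset hx.1 (hsub e he),
      by rw [Finset.card_insert_of_notMem hx.2, h_uniform e he]⟩
  calc E.card * k ≤ ∑ e ∈ E, ((T e \ e).image fun x => insert x e).card := by
        simpa using Finset.card_nsmul_le_sum E _ k hcard
    _ = (E.biUnion fun e => (T e \ e).image fun x => insert x e).card := by
        refine (Finset.card_biUnion ?_).symm
        intro e he f hf hef
        refine Finset.disjoint_left.2 fun S hS hS' => hef ?_
        obtain ⟨h₁, h₂, -⟩ := hmem e he S hS
        obtain ⟨h₃, h₄, -⟩ := hmem f hf S hS'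
        have hP : S ∈ charPoset E := mem_charPoset.2 ⟨e, he, h₁⟩
        exact congrArg Prod.fst
          ((hD.2.2 S hP).unique ⟨hT e he, h₁, h₂⟩ ⟨hT f hf, h₃, h₄⟩)
    _ ≤ _ := by
        refine Finset.card_le_card fun S hS => ?_
        obtain ⟨e, he, hS⟩ := Finset.mem_biUnion.1 hS
        obtain ⟨h₁, -, h₂⟩ := hmem e he S hS
        exact Finset.mem_filter.2 ⟨mem_charPoset.2 ⟨e, he, h₁⟩, h₂⟩

/-- Double counting of inclusions between edges and sets of size `d + 1`, when each of the latter
contains at least two edges. -/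
lemma card_filter_mul_two_le {E : Finset (Finset (Fin n))} {d : ℕ}
    (h_uniform : ∀ e ∈ E, e.card = d)
    (h_two : ∀ S ∈ charPoset E, S.card = d + 1 → 2 ≤ (E.filter fun e => e ⊆ S).card) :
    ((charPoset E).filter fun S => S.card = d + 1).card * 2 ≤ E.card * (n - d) := by
  refine Finset.card_mul_le_card_mul' (fun e S : Finset (Fin n) => e ⊆ S) ?_ ?_
  · intro S hS
    rw [Finset.mem_filter] at hS
    exact h_two S hS.1 hS.2
  · intro e he
    calc _ ≤ (eᶜ.image fun x => insert x e).card := by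
          refine Finset.card_le_card fun S hS => ?_
          rw [Finset.mem_bipartiteAbove, Finset.mem_filter] at hS
          obtain ⟨⟨-, hS⟩, heS⟩ := hS
          have h₁ : (S \ e).card = 1 := by
            rw [Finset.card_sdiff_of_subset heS, hS, h_uniform e he]; omega
          obtain ⟨x, hx⟩ := Finset.card_eq_one.1 h₁
          have hxS : x ∈ S \ e := hx ▸ Finset.mem_singleton_self x
          refine Finset.mem_image.2 ⟨x, Finset.mem_compl.2 (Finset.mem_sdiff.1 hxS).2, ?_⟩
          rw [Finset.insert_eq, ← hx, Finset.sdiff_union_of_subset heS]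
      _ ≤ eᶜ.card := Finset.card_image_le
      _ = n - d := by rw [Finset.card_compl, Fintype.card_fin, h_uniform e he]

/-- A `d`-set meeting each of `d` disjoint blocks covering the ground set meets each of them
exactly once. -/
lemma card_inter_eq_one_of_nonempty {d : ℕ} {V : Fin d → Finset (Fin n)}
    (hV_disjoint : ∀ i j, i ≠ j → Disjoint (V i) (V j)) {e : Finset (Fin n)} (he : e.card = d)
    (h : ∀ i, (e ∩ V i).Nonempty) (i : Fin d) : (e ∩ V i).card = 1 := by
  have hle : ∑ i, (e ∩ V i).card ≤ ∑ _i : Fin d, 1 := by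
    rw [← Finset.card_biUnion fun i _ j _ hij => (hV_disjoint i j hij).mono
      Finset.inter_subset_right Finset.inter_subset_right]
    refine (Finset.card_le_card
      (Finset.biUnion_subset.2 fun i _ => Finset.inter_subset_left)).trans ?_
    simp [he]
  have hge : ∀ i ∈ Finset.univ, 1 ≤ (e ∩ V i).card := fun i _ => (h i).card_pos
  exact (((Finset.sum_eq_sum_iff_of_le hge).1
    ((Finset.sum_le_sum hge).antisymm hle)) i (Finset.mem_univ i)).symm

/-- A set of size `d + 1` containing an edge of a complete `d`-partite clutter contains at least
two edges. -/
lemma two_le_card_filter_subset {d : ℕ} {E : Finset (Finset (Fin n))}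
    (h_uniform : ∀ e ∈ E, e.card = d) {V : Fin d → Finset (Fin n)}
    (hV_cover : ∀ i, IsVertexCover E (V i))
    (hV_disjoint : ∀ i j, i ≠ j → Disjoint (V i) (V j))
    (hV_union : ∀ x : Fin n, ∃ i, x ∈ V i)
    (h_complete : ∀ e : Finset (Fin n), e.card = d → (∀ i, (e ∩ V i).card = 1) → e ∈ E)
    {S : Finset (Fin n)} (hS : S ∈ charPoset E) (hSd : S.card = d + 1) :
    2 ≤ (E.filter fun e => e ⊆ S).card := by
  obtain ⟨e, he, heS⟩ := mem_charPoset.1 hS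
  obtain ⟨x, hxS, hxe⟩ := Finset.exists_mem_notMem_of_card_lt_card
    (show e.card < S.card by rw [h_uniform e he, hSd]; omega)
  obtain ⟨i, hi⟩ := hV_union x
  obtain ⟨y, hy⟩ := hV_cover i e he
  rw [Finset.mem_inter] at hy
  have hxe' : x ∉ e.erase y := fun h => hxe (Finset.mem_of_mem_erase h)
  have hcard : (insert x (e.erase y)).card = d := by
    rw [Finset.card_insert_of_notMem hxe', Finset.card_erase_add_one hy.1, h_uniform e he]
  have hf : insert x (e.erase y) ∈ E := by
    refine h_complete _ hcard (card_inter_eq_one_of_nonempty hV_disjoint hcard fun j => ?_)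
    obtain rfl | hij := eq_or_ne i j
    · exact ⟨x, Finset.mem_inter.2 ⟨Finset.mem_insert_self _ _, hi⟩⟩
    · obtain ⟨z, hz⟩ := hV_cover j e he
      rw [Finset.mem_inter] at hz
      have hzy : z ≠ y := by
        rintro rfl
        exact Finset.disjoint_left.1 (hV_disjoint i j hij) hy.2 hz.2
      exact ⟨z, Finset.mem_inter.2
        ⟨Finset.mem_insert_of_mem (Finset.mem_erase.2 ⟨hzy, hz.1⟩), hz.2⟩⟩
  refine Finset.one_lt_card.2 ⟨e, Finset.mem_filter.2 ⟨he, heS⟩, insert x (e.erase y),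
    Finset.mem_filter.2 ⟨hf, Finset.insert_subset hxS ((Finset.erase_subset _ _).trans heS)⟩, ?_⟩
  intro h
  exact hxe (h ▸ Finset.mem_insert_self _ _)

end IntervalPartition

/-- Let `C` be an integral `d`-uniform clutter on `[n]` whose edges cover `[n]`, whose
`d`-partite decomposition `[n] = V 0 ∪ ⋯ ∪ V (d-1)` into pairwise disjoint minimal vertex
covers is complete: every `d`-subset meeting each block exactly once is an edge. With
`r i = |V i|` and `P` the characteristic poset, `d ≤ sdepth P ≤ d + Σ_i (r i − 1)/2`. -/
theorem sdepth_integral_complete_clutter_bounds {n d : ℕ} (hd : 1 ≤ d)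
    (E : Finset (Finset (Fin n))) (hE : E.Nonempty)
    (h_uniform : ∀ e ∈ E, e.card = d)
    (h_antichain : ∀ e ∈ E, ∀ f ∈ E, e ⊆ f → e = f)
    (h_integral : IsIntegralClutter E)
    (h_cover : ∀ x : Fin n, ∃ e ∈ E, x ∈ e)
    (V : Fin d → Finset (Fin n))
    (hV_cover : ∀ i, IsMinimalVertexCover E (V i))
    (hV_disjoint : ∀ i j, i ≠ j → Disjoint (V i) (V j))
    (hV_union : ∀ x : Fin n, ∃ i, x ∈ V i)
    (h_complete : ∀ e : Finset (Fin n), e.card = d → (∀ i, (e ∩ V i).card = 1) → e ∈ E)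
    (r : Fin d → ℕ) (hr : ∀ i, r i = (V i).card) :
    d ≤ posetSdepth (charPoset E) ∧
      (posetSdepth (charPoset E) : ℚ) ≤ d + ∑ i, ((r i : ℚ) - 1) / 2 := by
  have hP : (charPoset E).Nonempty := hE.mono (subset_charPoset E)
  have hd_le : d ≤ posetSdepth (charPoset E) := by
    refine le_posetSdepth hP fun S hS => ?_
    obtain ⟨e, he, heS⟩ := mem_charPoset.1 hS
    exact h_uniform e he ▸ Finset.card_le_card heS
  refine ⟨hd_le, ?_⟩
  obtain ⟨k, hk⟩ := Nat.exists_eq_add_of_le hd_le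
  obtain ⟨D, hD, hDk⟩ := exists_isIntervalPartition_posetSdepth hP
  rw [hk] at hDk ⊢
  have h₁ := hD.card_mul_le h_uniform h_antichain hDk
  have h₂ := card_filter_mul_two_le h_uniform fun S hS hSd =>
    two_le_card_filter_subset h_uniform (fun i => (hV_cover i).1) hV_disjoint hV_union
      h_complete hS hSd
  have h₃ : k * 2 ≤ n - d := by
    refine le_of_mul_le_mul_left (a := E.card) ?_ hE.card_pos
    linarith
  have hdn : d ≤ n := by
    obtain ⟨e, he⟩ := hE
    simpa [h_uniform e he] using Finset.card_le_univ e
  have hn : ∑ i, r i = n := by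
    have hu : Finset.univ.biUnion V = Finset.univ := by
      ext x
      simpa using hV_union x
    simp_rw [hr]
    rw [← Finset.card_biUnion fun i _ j _ hij => hV_disjoint i j hij, hu, Finset.card_fin]
  have h₄ : (k : ℚ) * 2 + d ≤ n := by
    exact_mod_cast (show k * 2 + d ≤ n by omega)
  have hn' : ∑ i, (r i : ℚ) = n := by exact_mod_cast hn
  rw [← Finset.sum_div, Finset.sum_sub_distrib, hn']
  simp only [Finset.sum_const, Finset.card_univ, Fintype.card_fin, nsmul_eq_mul, mul_one]
  push_cast
  linarith
end

section
/- Let n ≥ 4 and let [n] = V_1 ∪ V_2 be a partition into two disjoint nonempty blocks, determining the complete bipartite graph whose edges are all pairs {i,j} with i ∈ V_1, j ∈ V_2. Let P = {C ⊆ [n] : C contains some edge} be the characteristic poset of its edge ideal. Then sdepth(P) ≤ (n+2)/2. -/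
/-- The edge set of the complete bipartite graph on the partition `[n] = V₁ ∪ V₂`:
all pairs `{i, j}` with `i ∈ V₁` and `j ∈ V₂`. -/
def completeBipartiteEdges {n : ℕ} (V₁ V₂ : Finset (Fin n)) : Finset (Finset (Fin n)) :=
  (V₁ ×ˢ V₂).image (fun p => ({p.1, p.2} : Finset (Fin n)))

/-- A set belongs to the characteristic poset of a complete bipartite graph iff it contains a vertex
of each block. -/
theorem mem_charPoset_completeBipartiteEdges {n : ℕ} {V₁ V₂ S : Finset (Fin n)} :
    S ∈ charPoset (completeBipartiteEdges V₁ V₂) ↔ ∃ i ∈ V₁, ∃ j ∈ V₂, i ∈ S ∧ j ∈ S := by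
  simp only [charPoset, completeBipartiteEdges, Finset.mem_filter, Finset.mem_univ, true_and,
    Finset.mem_image, Finset.mem_product, Prod.exists]
  constructor
  · rintro ⟨e, ⟨i, j, ⟨hi, hj⟩, rfl⟩, he⟩
    exact ⟨i, hi, j, hj, he (by simp), he (by simp)⟩
  · rintro ⟨i, hi, j, hj, his, hjs⟩
    exact ⟨_, ⟨i, j, ⟨hi, hj⟩, rfl⟩, by simp [Finset.insert_subset_iff, his, hjs]⟩

/-- In an interval partition of the characteristic poset of a complete bipartite graph, every edge
is the bottom of one of the intervals. -/
theorem IsIntervalPartition.exists_edge_mem {n : ℕ} {V₁ V₂ : Finset (Fin n)}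
    (h_disjoint : Disjoint V₁ V₂) {D : Finset (Finset (Fin n) × Finset (Fin n))}
    (hD : IsIntervalPartition (charPoset (completeBipartiteEdges V₁ V₂)) D)
    {i j : Fin n} (hi : i ∈ V₁) (hj : j ∈ V₂) :
    ∃ T, (({i, j} : Finset (Fin n)), T) ∈ D := by
  obtain ⟨⟨C, T⟩, ⟨hCT, hC, -⟩, -⟩ := hD.2.2 {i, j}
    (mem_charPoset_completeBipartiteEdges.2 ⟨i, hi, j, hj, by simp, by simp⟩)
  obtain ⟨i', hi', j', hj', hiC, hjC⟩ := mem_charPoset_completeBipartiteEdges.1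
    (hD.2.1 _ hCT C subset_rfl (hD.1 _ hCT))
  have h := Finset.disjoint_left.1 h_disjoint
  have hii : i' = i := by
    have := hC hiC
    simp only [Finset.mem_insert, Finset.mem_singleton] at this
    rcases this with rfl | rfl
    · rfl
    · exact absurd hj (h hi')
  have hjj : j' = j := by
    have := hC hjC
    simp only [Finset.mem_insert, Finset.mem_singleton] at this
    rcases this with rfl | rfl
    · exact absurd hj' (h hi)
    · rfl
  subst hii hjj
  refine ⟨T, ?_⟩
  have hCe : C = {i', j'} := hC.antisymm (by
    simp [Finset.insert_subset_iff, hiC, hjC])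
  rwa [← hCe]

/-- Two intervals of a partition that share a member of the family coincide. -/
theorem IsIntervalPartition.eq_of_mem {n : ℕ} {P : Finset (Finset (Fin n))}
    {D : Finset (Finset (Fin n) × Finset (Fin n))} (hD : IsIntervalPartition P D)
    {p q : Finset (Fin n) × Finset (Fin n)} (hp : p ∈ D) (hq : q ∈ D) {S : Finset (Fin n)}
    (hpS : p.1 ⊆ S) (hSp : S ⊆ p.2) (hqS : q.1 ⊆ S) (hSq : S ⊆ q.2) : p = q :=
  (hD.2.2 S (hD.2.1 p hp S hpS hSp)).unique ⟨hp, hpS, hSp⟩ ⟨hq, hqS, hSq⟩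

/-- An edge `(i, j)` and a further vertex `x` form a triple containing exactly one other edge; this
swaps the edge for that other one, and `x` for the vertex then left over. -/
def swapEdge {n : ℕ} (V₁ : Finset (Fin n)) (t : (_ : Fin n × Fin n) × Fin n) :
    (_ : Fin n × Fin n) × Fin n :=
  if t.2 ∈ V₁ then ⟨(t.2, t.1.2), t.1.1⟩ else ⟨(t.1.1, t.2), t.1.2⟩

/-- If all intervals of a partition have tops with at least `m` elements, then
`2 * m ≤ n + 2`. -/
theorem IsIntervalPartition.two_mul_le {n : ℕ} (hn : 4 ≤ n) {V₁ V₂ : Finset (Fin n)}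
    (h₁ : V₁.Nonempty) (h₂ : V₂.Nonempty) (h_disjoint : Disjoint V₁ V₂)
    (h_union : V₁ ∪ V₂ = Finset.univ) {D : Finset (Finset (Fin n) × Finset (Fin n))}
    (hD : IsIntervalPartition (charPoset (completeBipartiteEdges V₁ V₂)) D)
    {m : ℕ} (hm : ∀ p ∈ D, m ≤ p.2.card) : 2 * m ≤ n + 2 := by
  classical
  have hdisj : ∀ x, x ∈ V₁ → x ∉ V₂ := fun x hx =>
    Finset.disjoint_left.1 h_disjoint hx
  have hcov : ∀ x, x ∉ V₁ → x ∈ V₂ := fun x hx => by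
    have : x ∈ V₁ ∪ V₂ := h_union ▸ Finset.mem_univ x
    exact (Finset.mem_union.1 this).resolve_left hx
  have hex : ∀ e : Fin n × Fin n, ∃ T, e.1 ∈ V₁ → e.2 ∈ V₂ →
      (({e.1, e.2} : Finset (Fin n)), T) ∈ D := by
    intro e
    by_cases h : e.1 ∈ V₁ ∧ e.2 ∈ V₂
    · obtain ⟨T, hT⟩ := hD.exists_edge_mem h_disjoint h.1 h.2
      exact ⟨T, fun _ _ => hT⟩
    · exact ⟨∅, fun a b => absurd ⟨a, b⟩ h⟩
  choose d hd using hex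
  set Ω : Finset ((_ : Fin n × Fin n) × Fin n) :=
    (V₁ ×ˢ V₂).sigma fun e => Finset.univ \ {e.1, e.2} with hΩ
  set A : Finset ((_ : Fin n × Fin n) × Fin n) :=
    (V₁ ×ˢ V₂).sigma fun e => d e \ {e.1, e.2} with hA
  have hpair : ∀ e ∈ V₁ ×ˢ V₂, ({e.1, e.2} : Finset (Fin n)).card = 2 := by
    rintro ⟨i, j⟩ he
    rw [Finset.mem_product] at he
    exact Finset.card_pair fun h : i = j => hdisj i he.1 (h ▸ he.2)
  have hAΩ : A ⊆ Ω := Finset.sigma_mono subset_rfl fun e =>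
    Finset.sdiff_subset_sdiff (Finset.subset_univ _) subset_rfl
  have memΩ : ∀ i j x, (⟨(i, j), x⟩ : (_ : Fin n × Fin n) × Fin n) ∈ Ω ↔
      (i ∈ V₁ ∧ j ∈ V₂) ∧ x ≠ i ∧ x ≠ j := by
    intro i j x; simp [hΩ]
  have memA : ∀ i j x, (⟨(i, j), x⟩ : (_ : Fin n × Fin n) × Fin n) ∈ A ↔
      (i ∈ V₁ ∧ j ∈ V₂) ∧ x ∈ d (i, j) ∧ x ≠ i ∧ x ≠ j := by
    intro i j x; simp [hA]
  have hmaps : ∀ t ∈ Ω, swapEdge V₁ t ∈ Ω := by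
    rintro ⟨⟨i, j⟩, x⟩ ht
    have := hcov x
    rw [memΩ] at ht
    unfold swapEdge
    split_ifs <;> rw [memΩ] <;> grind
  have hinvol : ∀ t ∈ Ω, swapEdge V₁ (swapEdge V₁ t) = t := by
    rintro ⟨⟨i, j⟩, x⟩ ht
    rw [memΩ] at ht
    have hjV : j ∉ V₁ := fun h => hdisj j h ht.1.2
    unfold swapEdge
    by_cases hx : x ∈ V₁ <;> simp [hx, ht.1.1, hjV]
  have hnot : ∀ t ∈ A, swapEdge V₁ t ∉ A := by
    rintro ⟨⟨i, j⟩, x⟩ ht ht'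
    rw [memA] at ht
    obtain ⟨⟨hi, hj⟩, hx, hxi, hxj⟩ := ht
    have hij := hd (i, j) hi hj
    have hij' := hD.1 _ hij
    unfold swapEdge at ht'
    split_ifs at ht' with hxV <;> simp only [memA] at ht'
    · obtain ⟨⟨hi', hj'⟩, hx', -, -⟩ := ht'
      have h' := hd (x, j) hi' hj'
      have h'' := hD.1 _ h'
      have := hD.eq_of_mem hij h' (S := {i, j, x}) (by grind) (by grind) (by grind) (by grind)
      have h3 : x ∈ ({i, j} : Finset (Fin n)) := by
        rw [show ({i, j} : Finset (Fin n)) = {x, j} from congrArg Prod.fst this]; simp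
      grind
    · obtain ⟨⟨hi', hj'⟩, hx', -, -⟩ := ht'
      have h' := hd (i, x) hi' hj'
      have h'' := hD.1 _ h'
      have := hD.eq_of_mem hij h' (S := {i, j, x}) (by grind) (by grind) (by grind) (by grind)
      have h3 : x ∈ ({i, j} : Finset (Fin n)) := by
        rw [show ({i, j} : Finset (Fin n)) = {i, x} from congrArg Prod.fst this]; simp
      grind
  have hinj : Set.InjOn (swapEdge V₁) (A : Set ((_ : Fin n × Fin n) × Fin n)) := by
    intro s hs t ht hst
    rw [← hinvol s (hAΩ hs), hst, hinvol t (hAΩ ht)]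
  have hdis : Disjoint A (A.image (swapEdge V₁)) := by
    rw [Finset.disjoint_right]
    intro t ht
    obtain ⟨s, hs, rfl⟩ := Finset.mem_image.1 ht
    exact hnot s hs
  have hle : 2 * A.card ≤ Ω.card := by
    have h := Finset.card_le_card (Finset.union_subset hAΩ
      (Finset.image_subset_iff.2 fun t ht => hmaps t (hAΩ ht)))
    rw [Finset.card_union_of_disjoint hdis, Finset.card_image_of_injOn hinj] at h
    omega
  have hcardΩ : Ω.card = (V₁ ×ˢ V₂).card * (n - 2) := by
    rw [hΩ, Finset.card_sigma]
    refine Finset.sum_const_nat fun e he => ?_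
    rw [Finset.card_sdiff_of_subset (Finset.subset_univ _), hpair e he, Finset.card_univ,
      Fintype.card_fin]
  have hcardA : (V₁ ×ˢ V₂).card * (m - 2) ≤ A.card := by
    rw [hA, Finset.card_sigma, ← smul_eq_mul]
    refine Finset.card_nsmul_le_sum _ _ _ fun e he => ?_
    have he' := Finset.mem_product.1 he
    have h := hd e he'.1 he'.2
    rw [Finset.card_sdiff_of_subset (hD.1 _ h), hpair e he]
    exact Nat.sub_le_sub_right (hm _ h) 2
  have hpos : 0 < (V₁ ×ˢ V₂).card := Finset.card_pos.2 (h₁.product h₂)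
  have : 2 * (m - 2) ≤ n - 2 := by
    refine Nat.le_of_mul_le_mul_left ?_ hpos
    rw [← hcardΩ]
    linarith
  omega

/-- (Ishaq) Let `n ≥ 4` and let `[n] = V₁ ∪ V₂` be a partition into two disjoint nonempty
blocks, determining a complete bipartite graph. Then the Stanley depth of the characteristic
poset of its edge ideal is at most `(n + 2)/2`. -/
theorem sdepth_complete_bipartite_le {n : ℕ} (hn : 4 ≤ n)
    (V₁ V₂ : Finset (Fin n))
    (h₁ : V₁.Nonempty) (h₂ : V₂.Nonempty)
    (h_disjoint : Disjoint V₁ V₂)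
    (h_union : V₁ ∪ V₂ = Finset.univ) :
    (posetSdepth (charPoset (completeBipartiteEdges V₁ V₂)) : ℚ) ≤ (n + 2) / 2 := by
  have h : posetSdepth (charPoset (completeBipartiteEdges V₁ V₂)) ≤ (n + 2) / 2 := by
    refine csSup_le' ?_
    rintro m ⟨D, hD, hm⟩
    have := hD.two_mul_le hn h₁ h₂ h_disjoint h_union hm
    omega
  have h' : 2 * posetSdepth (charPoset (completeBipartiteEdges V₁ V₂)) ≤ n + 2 := by omega
  have h'' : (2 * posetSdepth (charPoset (completeBipartiteEdges V₁ V₂)) : ℚ) ≤ n + 2 := by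
    exact_mod_cast h'
  linarith
end

section
/- Let d ≤ k and let [n] = V_1 ∪ ⋯ ∪ V_k be a partition into k disjoint nonempty blocks. Let C be the d-uniform complete k-partite clutter determined by this partition and let I(C) ⊆ K[x_1,…,x_n] be its edge ideal. For each i let I_i = (V_i) be the ideal generated by the variables {x_j : j ∈ V_i}. Then I(C) = Σ_{1≤j_1<j_2<⋯<j_d≤k} I_{j_1} ∩ I_{j_2} ∩ ⋯ ∩ I_{j_d}. -/
open MvPolynomial

/-- The edge set of the `d`-uniform complete `k`-partite clutter on the partition
`[n] = V 0 ∪ ⋯ ∪ V (k-1)`: all `d`-element subsets meeting every block at most once. -/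
def completeKPartiteEdges {n k : ℕ} (V : Fin k → Finset (Fin n)) (d : ℕ) :
    Finset (Finset (Fin n)) :=
  (Finset.powersetCard d (Finset.univ : Finset (Fin n))).filter
    (fun e => ∀ i, (e ∩ V i).card ≤ 1)

theorem MvPolynomial.prod_X_dvd_monomial {σ R : Type*} [CommSemiring R] {e : Finset σ}
    {m : σ →₀ ℕ} (h : ∀ j ∈ e, m j ≠ 0) (a : R) :
    ∏ j ∈ e, (X j : MvPolynomial σ R) ∣ monomial m a := by
  rw [monomial_eq]
  refine Dvd.dvd.mul_left ?_ _
  calc ∏ j ∈ e, (X j : MvPolynomial σ R)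
      ∣ ∏ j ∈ e, X j ^ m j := Finset.prod_dvd_prod_of_dvd _ _ fun j hj => dvd_pow_self _ (h j hj)
    _ ∣ ∏ j ∈ m.support, X j ^ m j :=
      Finset.prod_dvd_prod_of_subset _ _ _ fun j hj => Finsupp.mem_support_iff.2 (h j hj)

theorem MvPolynomial.mem_ideal_span_X_iff {σ R : Type*} [CommSemiring R] {s : Finset σ}
    {p : MvPolynomial σ R} :
    p ∈ Ideal.span { q : MvPolynomial σ R | ∃ j ∈ s, q = X j } ↔
      ∀ m ∈ p.support, ∃ j ∈ s, m j ≠ 0 := by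
  have h : { q : MvPolynomial σ R | ∃ j ∈ s, q = X j } = X '' (s : Set σ) := by
    ext q
    simp [eq_comm]
  simp [h, mem_ideal_span_X_image]

theorem mem_completeKPartiteEdges {n k d : ℕ} {V : Fin k → Finset (Fin n)} {e : Finset (Fin n)} :
    e ∈ completeKPartiteEdges V d ↔ e.card = d ∧ ∀ i, (e ∩ V i).card ≤ 1 := by
  simp [completeKPartiteEdges]

/-- Choosing one vertex from each of `d` disjoint blocks gives an edge. -/
theorem image_mem_completeKPartiteEdges {n k : ℕ} {V : Fin k → Finset (Fin n)}
    (hV : ∀ i j, i ≠ j → Disjoint (V i) (V j)) {s : Finset (Fin k)} {c : Fin k → Fin n}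
    (hc : ∀ i ∈ s, c i ∈ V i) : s.image c ∈ completeKPartiteEdges V s.card := by
  have block_unique {i j : Fin k} {x : Fin n} (hi : x ∈ V i) (hj : x ∈ V j) : i = j := by
    by_contra hij
    exact Finset.disjoint_left.1 (hV i j hij) hi hj
  refine mem_completeKPartiteEdges.2 ⟨Finset.card_image_of_injOn fun i hi j hj hij => ?_,
    fun i => Finset.card_le_one.2 ?_⟩
  · exact block_unique (hc i hi) (hij ▸ hc j hj)
  · simp only [Finset.mem_inter, Finset.mem_image]
    rintro _ ⟨⟨a, ha, rfl⟩, hai⟩ _ ⟨⟨b, hb, rfl⟩, hbi⟩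
    rw [block_unique (hc a ha) hai, block_unique (hc b hb) hbi]

/-- Let `d ≤ k`, let `[n] = V 0 ∪ ⋯ ∪ V (k-1)` be a partition into `k` disjoint nonempty
blocks, let `I(C) ⊆ K[x_1,…,x_n]` be the edge ideal of the `d`-uniform complete `k`-partite
clutter `C` on this partition, and for each `i` let `I i = (V i)` be the ideal generated by
the variables indexed by `V i`. Then `I(C) = Σ_{s ⊆ [k], |s| = d} ⋂_{j ∈ s} I j`. -/
theorem edgeIdeal_eq_sum_of_intersections {n k d : ℕ} (hdk : d ≤ k)
    (K : Type*) [Field K]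
    (V : Fin k → Finset (Fin n))
    (hV_nonempty : ∀ i, (V i).Nonempty)
    (hV_disjoint : ∀ i j, i ≠ j → Disjoint (V i) (V j))
    (hV_cover : ∀ x : Fin n, ∃ i, x ∈ V i) :
    Ideal.span { m : MvPolynomial (Fin n) K |
        ∃ e ∈ completeKPartiteEdges V d, m = ∏ j ∈ e, MvPolynomial.X j } =
      ∑ s ∈ Finset.powersetCard d (Finset.univ : Finset (Fin k)),
        s.inf (fun i => Ideal.span { p : MvPolynomial (Fin n) K |
          ∃ j ∈ V i, p = MvPolynomial.X j }) := by
  rw [Ideal.sum_eq_sup]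
  apply le_antisymm
  · rw [Ideal.span_le]
    rintro _ ⟨e, he, rfl⟩
    obtain ⟨hcard, hinter⟩ := mem_completeKPartiteEdges.1 he
    choose b hb using hV_cover
    have hinj : Set.InjOn b e := fun x hx y hy hxy =>
      Finset.card_le_one.1 (hinter (b x)) x (Finset.mem_inter.2 ⟨hx, hb x⟩) y
        (Finset.mem_inter.2 ⟨hy, hxy ▸ hb y⟩)
    have hs : e.image b ∈ Finset.powersetCard d Finset.univ := by
      simp [Finset.mem_powersetCard, Finset.card_image_of_injOn hinj, hcard]
    refine Finset.le_sup (f := fun s : Finset (Fin k) => s.inf fun i =>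
      Ideal.span { p : MvPolynomial (Fin n) K | ∃ j ∈ V i, p = X j }) hs ?_
    simp only [Submodule.mem_finsetInf, Finset.mem_image]
    rintro _ ⟨x, hx, rfl⟩
    exact Ideal.mem_of_dvd _ (Finset.dvd_prod_of_mem _ hx) (Ideal.subset_span ⟨x, hb x, rfl⟩)
  · refine Finset.sup_le fun s hs p hp => ?_
    obtain rfl := (Finset.mem_powersetCard.1 hs).2
    simp only [Submodule.mem_finsetInf, mem_ideal_span_X_iff] at hp
    rw [← support_sum_monomial_coeff p]
    refine Ideal.sum_mem _ fun m hm => ?_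
    have hc (i : Fin k) : ∃ j ∈ V i, i ∈ s → m j ≠ 0 := by
      by_cases hi : i ∈ s
      · obtain ⟨j, hj, hmj⟩ := hp i hi m hm
        exact ⟨j, hj, fun _ => hmj⟩
      · obtain ⟨j, hj⟩ := hV_nonempty i
        exact ⟨j, hj, fun h => absurd h hi⟩
    choose c hcV hcm using hc
    refine Ideal.mem_of_dvd _ (prod_X_dvd_monomial (e := s.image c) ?_ _) (Ideal.subset_span
      ⟨_, image_mem_completeKPartiteEdges hV_disjoint fun i _ => hcV i, rfl⟩)
    simpa [Finset.mem_image] using hcm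
end
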